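/- arXiv:2003.09495 — 9 statements merged into one kernel-verified Lean document; each statement's English description precedes it below -/
import Mathlib

section
/- Let A ⊆ ℝⁿ be a nonempty finite set, β ∈ ℝⁿ \ A, and c ∈ ℝ^{A∪{β}} with c_α ≥ 0 for all α ∈ A. Then c ∈ Pᵉ(A, β) if and only if there exists ν : A → ℝ≥0 such that Σ_{α∈A} ν_α·α = (Σ_{α∈A} ν_α)·β and Σ_{α∈A, ν_α>0} ν_α·ln(ν_α/(e·c_α)) ≤ c_β, where the condition fails if ν_α > 0 and c_α = 0 for some α (the relative-entropy term is then +∞). -/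
attribute [local instance] Classical.propDecidable

theorem aux_eps {ι : Type*} [Fintype ι] {n : ℕ} (w : ι → Fin n → ℝ) (c : ι → ℝ)
    (hc : ∀ a, 0 ≤ c a) (b : ℝ)
    (h : ∀ y : Fin n → ℝ, -b ≤ ∑ a, c a * Real.exp (∑ i, w a i * y i)) (ε : ℝ) (hε : 0 < ε) :
    ∃ ν : ι → ℝ, (∀ a, 0 ≤ ν a) ∧ (∀ a, ν a ≤ ∑ a, c a) ∧
      (∀ i, (∑ a, ν a * w a i) ^ 2 ≤ ε * (2 * ∑ a, c a)) ∧ (∀ a, c a = 0 → ν a = 0) ∧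
      ∑ a, (ν a * Real.log (ν a) - ν a * Real.log (Real.exp 1 * c a)) ≤ b := by
  classical
  set C := ∑ a, c a with hC
  let G : (Fin n → ℝ) → ℝ := fun y =>
    ∑ a, c a * Real.exp (∑ i, w a i * y i) + ε / 2 * ∑ i, y i ^ 2
  have hG0 : G 0 = C := by simp [G, hC]
  have hF0 : ∀ y : Fin n → ℝ, 0 ≤ ∑ a, c a * Real.exp (∑ i, w a i * y i) := fun y =>
    Finset.sum_nonneg fun a _ => mul_nonneg (hc a) (Real.exp_pos _).le
  have hGc : Continuous G := by fun_prop
  have hnorm : ∀ y : Fin n → ℝ, ‖y‖ ^ 2 ≤ ∑ i, y i ^ 2 := by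
    intro y
    have hs : 0 ≤ ∑ i, y i ^ 2 := Finset.sum_nonneg fun i _ => sq_nonneg _
    rw [← Real.le_sqrt (norm_nonneg _) hs]
    refine (pi_norm_le_iff_of_nonneg (Real.sqrt_nonneg _)).2 fun i => ?_
    apply Real.le_sqrt_of_sq_le
    rw [Real.norm_eq_abs, sq_abs]
    exact Finset.single_le_sum (f := fun i => y i ^ 2) (fun i _ => sq_nonneg _) (Finset.mem_univ i)
  have hcoer : ∀ᶠ y in Filter.cocompact (Fin n → ℝ), G 0 ≤ G y := by
    have h1 : Filter.Tendsto (fun y : Fin n → ℝ => ε / 2 * ‖y‖ ^ 2)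
        (Filter.cocompact _) Filter.atTop :=
      ((Filter.tendsto_pow_atTop two_ne_zero).comp
        (tendsto_norm_cocompact_atTop)).const_mul_atTop (by positivity)
    filter_upwards [h1.eventually_ge_atTop (G 0)] with y hy
    have := mul_le_mul_of_nonneg_left (hnorm y) (half_pos hε).le
    have := hF0 y
    simp only [G] at hy ⊢
    linarith
  obtain ⟨y, hy⟩ := hGc.exists_forall_le' 0 hcoer
  have hyC : G y ≤ C := hG0 ▸ hy 0
  have hsq : 0 ≤ ∑ i, y i ^ 2 := Finset.sum_nonneg fun i _ => sq_nonneg _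
  have hgrad : ∀ i, ∑ a, c a * Real.exp (∑ i, w a i * y i) * w a i = - (ε * y i) := by
    intro i
    let g : ℝ → ℝ := fun t => ∑ a, c a * Real.exp (∑ j, w a j * y j + t * w a i)
      + ε / 2 * (∑ j, y j ^ 2 + 2 * t * y i + t ^ 2)
    have hg : ∀ t, g t = G (y + Pi.single i t) := by
      intro t
      simp only [g, G, Pi.add_apply]
      congr 1
      · refine Finset.sum_congr rfl fun a _ => ?_
        congr 2
        simp only [mul_add, Finset.sum_add_distrib]
        congr 1
        simp [Pi.single_apply, mul_comm]
      · congr 1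
        simp only [add_sq, Finset.sum_add_distrib]
        congr 1
        · congr 1
          simp [Pi.single_apply]
          ring
        · simp [Pi.single_apply]
    have hmin : IsLocalMin g 0 := by
      refine Filter.Eventually.of_forall fun t => ?_
      rw [hg, hg]
      simpa using hy _
    have hd : HasDerivAt g (∑ a, c a * (Real.exp (∑ j, w a j * y j + 0 * w a i) * (1 * w a i))
      + ε / 2 * (2 * 1 * y i + 2 * 0)) 0 := by
      refine HasDerivAt.add ?_ ?_
      · refine HasDerivAt.fun_sum fun a _ => ?_
        exact ((((hasDerivAt_id (0:ℝ)).mul_const (w a i)).const_add _).exp).const_mul _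
      · refine HasDerivAt.const_mul _ ?_
        refine HasDerivAt.add ?_ ?_
        · exact ((((hasDerivAt_id (0:ℝ)).const_mul 2).mul_const (y i)).const_add _)
        · simpa using hasDerivAt_pow 2 (0:ℝ)
    have h0 := hmin.hasDerivAt_eq_zero hd
    simp only [zero_mul, add_zero, one_mul, ← mul_assoc] at h0
    linarith
  refine ⟨fun a => c a * Real.exp (∑ i, w a i * y i), fun a => mul_nonneg (hc a) (Real.exp_pos _).le,
    fun a => ?_, fun i => ?_, fun a ha => by simp [ha], ?_⟩
  · have h1 := Finset.single_le_sum (f := fun a => c a * Real.exp (∑ i, w a i * y i))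
      (fun a _ => mul_nonneg (hc a) (Real.exp_pos _).le) (Finset.mem_univ a)
    have : 0 ≤ ε / 2 * ∑ i, y i ^ 2 := by positivity
    simp only [G] at hyC h1 ⊢
    linarith
  · rw [hgrad i]
    have h1 := Finset.single_le_sum (f := fun i => y i ^ 2) (fun i _ => sq_nonneg _)
      (Finset.mem_univ i)
    have h2 := hF0 y
    simp only [G] at hyC h1
    have h3 : ε * y i ^ 2 ≤ 2 * C := by nlinarith
    calc (-(ε * y i)) ^ 2 = ε * (ε * y i ^ 2) := by ring
      _ ≤ _ := mul_le_mul_of_nonneg_left h3 hε.le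
  · have key : ∑ a, ((c a * Real.exp (∑ i, w a i * y i)) * Real.log (c a * Real.exp (∑ i, w a i * y i))
        - (c a * Real.exp (∑ i, w a i * y i)) * Real.log (Real.exp 1 * c a))
        = ∑ a, ((c a * Real.exp (∑ i, w a i * y i)) * (∑ i, w a i * y i)
          - (c a * Real.exp (∑ i, w a i * y i))) := by
      refine Finset.sum_congr rfl fun a _ => ?_
      by_cases ha : c a = 0
      · simp [ha]
      · rw [Real.log_mul ha (Real.exp_pos _).ne', Real.log_mul (Real.exp_pos _).ne' ha,
          Real.log_exp, Real.log_exp]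
        ring
    rw [key, Finset.sum_sub_distrib]
    have h1 : ∑ a, (c a * Real.exp (∑ i, w a i * y i)) * (∑ i, w a i * y i)
        = - (ε * ∑ i, y i ^ 2) := by
      calc _ = ∑ i, (∑ a, c a * Real.exp (∑ i, w a i * y i) * w a i) * y i := by
            simp only [Finset.mul_sum, Finset.sum_mul]
            rw [Finset.sum_comm]
            simp only [mul_assoc]
        _ = _ := by
            simp only [hgrad, Finset.mul_sum, ← Finset.sum_neg_distrib]
            exact Finset.sum_congr rfl fun i _ => by ring
    rw [h1]
    have := h y
    have : 0 ≤ ε * ∑ i, y i ^ 2 := by positivity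
    linarith

theorem aux_lim {ι : Type*} [Fintype ι] {n : ℕ} (w : ι → Fin n → ℝ) (c : ι → ℝ)
    (hc : ∀ a, 0 ≤ c a) (b : ℝ)
    (h : ∀ y : Fin n → ℝ, -b ≤ ∑ a, c a * Real.exp (∑ i, w a i * y i)) :
    ∃ ν : ι → ℝ, (∀ a, 0 ≤ ν a) ∧
      (∀ i, ∑ a, ν a * w a i = 0) ∧ (∀ a, c a = 0 → ν a = 0) ∧
      ∑ a, (ν a * Real.log (ν a) - ν a * Real.log (Real.exp 1 * c a)) ≤ b := by
  choose ν h0 h1 h2 h3 h4 using fun k : ℕ => aux_eps w c hc b h (1 / ((k : ℝ) + 1)) (by positivity)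
  obtain ⟨μ, hμ, φ, hφ, hlim⟩ := (isCompact_Icc (a := (0 : ι → ℝ)) (b := fun _ => ∑ a, c a)).tendsto_subseq
    (x := ν) (fun k => ⟨fun a => h0 k a, fun a => h1 k a⟩)
  have hl : ∀ a, Filter.Tendsto (fun k => ν (φ k) a) Filter.atTop (nhds (μ a)) := fun a =>
    (tendsto_pi_nhds.1 hlim) a
  refine ⟨μ, fun a => hμ.1 a, fun i => ?_, fun a ha => ?_, ?_⟩
  · have e1 : Filter.Tendsto (fun k => (∑ a, ν (φ k) a * w a i) ^ 2) Filter.atTop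
        (nhds ((∑ a, μ a * w a i) ^ 2)) :=
      (tendsto_finsetSum _ fun a _ => (hl a).mul_const _).pow 2
    have e2 : Filter.Tendsto (fun k => 1 / ((φ k : ℝ) + 1) * (2 * ∑ a, c a)) Filter.atTop
        (nhds (0 * (2 * ∑ a, c a))) :=
      ((tendsto_one_div_add_atTop_nhds_zero_nat (𝕜 := ℝ)).comp hφ.tendsto_atTop).mul_const _
    have := le_of_tendsto_of_tendsto' e1 e2 fun k => h2 (φ k) i
    rw [zero_mul] at this
    exact pow_eq_zero_iff two_ne_zero |>.1 (le_antisymm this (sq_nonneg _))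
  · refine tendsto_nhds_unique (hl a) ?_
    simp [h3 _ a ha]
  · refine le_of_tendsto' (x := Filter.atTop) (tendsto_finsetSum _ fun a _ => ?_) fun k => h4 (φ k)
    exact ((Real.continuous_mul_log.tendsto _).comp (hl a)).sub ((hl a).mul_const _)

theorem aux_term (c ν t : ℝ) (hc : 0 ≤ c) (hν : 0 < ν) (h : 0 < ν → 0 < c) :
    ν * t - ν * Real.log (ν / (Real.exp 1 * c)) ≤ c * Real.exp t := by
  have hc := h hν
  have h1 := Real.add_one_le_exp (t - Real.log (ν / c))
  rw [Real.exp_sub, Real.exp_log (by positivity)] at h1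
  have h2 : Real.log (ν / (Real.exp 1 * c)) = Real.log (ν / c) - 1 := by
    rw [Real.log_div hν.ne' (by positivity), Real.log_mul (by positivity) hc.ne',
      Real.log_div hν.ne' hc.ne', Real.log_exp]
    ring
  rw [h2]
  have h3 := mul_le_mul_of_nonneg_left h1 hν.le
  have h4 : ν * (Real.exp t / (ν / c)) = c * Real.exp t := by field_simp
  linarith

/-- Relative-entropy characterization of membership in the cone `Pᵉ(A, β)` of
nonnegative even AG functions. -/
theorem stmt1 (n : ℕ) (A : Finset (Fin n → ℝ)) (hA : A.Nonempty)
    (β : Fin n → ℝ) (hβ : β ∉ A)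
    (c : (Fin n → ℝ) → ℝ) (hc : ∀ α ∈ A, 0 ≤ c α) :
    (∀ y : Fin n → ℝ,
        0 ≤ ∑ α ∈ A, c α * Real.exp (∑ i, α i * y i)
              + c β * Real.exp (∑ i, β i * y i))
      ↔ ∃ ν : (Fin n → ℝ) → ℝ,
          (∀ α ∈ A, 0 ≤ ν α) ∧
          (∑ α ∈ A, ν α • α) = (∑ α ∈ A, ν α) • β ∧
          (∀ α ∈ A, 0 < ν α → 0 < c α) ∧
          ∑ α ∈ A.filter (fun α => 0 < ν α),
              ν α * Real.log (ν α / (Real.exp 1 * c α)) ≤ c β := by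
  have hfac : ∀ y : Fin n → ℝ, ∑ α ∈ A, c α * Real.exp (∑ i, α i * y i)
      + c β * Real.exp (∑ i, β i * y i)
      = Real.exp (∑ i, β i * y i) * (∑ α ∈ A, c α * Real.exp (∑ i, (α i - β i) * y i) + c β) := by
    intro y
    rw [mul_add, Finset.mul_sum]
    congr 1
    · refine Finset.sum_congr rfl fun α _ => ?_
      rw [mul_left_comm, ← Real.exp_add, ← Finset.sum_add_distrib]
      congr 3
      ext i
      ring
    · ring
  simp only [hfac, mul_nonneg_iff_of_pos_left (Real.exp_pos _)]
  constructor
  · intro h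
    obtain ⟨ν, h0, h1, h2, h3⟩ := aux_lim (ι := A) (fun a i => a.1 i - β i) (fun a => c a)
      (fun a => hc a a.2) (c β) (fun y => by
        have := h y
        rw [← Finset.sum_coe_sort] at this
        linarith)
    let μ : (Fin n → ℝ) → ℝ := fun α => if hα : α ∈ A then ν ⟨α, hα⟩ else 0
    have hμ : ∀ a : A, μ a = ν a := fun a => by simp [μ]
    have hμc : ∀ α ∈ A, 0 < μ α → 0 < c α := by
      intro α hα hp
      refine lt_of_le_of_ne (hc α hα) fun h => ?_
      have := h2 ⟨α, hα⟩ h.symm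
      rw [hμ ⟨α, hα⟩, this] at hp
      exact lt_irrefl _ hp
    have hμ0 : ∀ α ∈ A, 0 ≤ μ α := fun α hα => (h0 ⟨α, hα⟩).trans_eq (hμ ⟨α, hα⟩).symm
    refine ⟨μ, hμ0, ?_, hμc, ?_⟩
    · ext i
      have := h1 i
      simp only [← hμ] at this
      rw [Finset.sum_coe_sort A (fun α => μ α * (α i - β i))] at this
      simp only [mul_sub, Finset.sum_sub_distrib, ← Finset.sum_mul] at this
      simp only [Finset.sum_apply, Pi.smul_apply, smul_eq_mul]
      linarith
    · simp only [← hμ] at h3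
      rw [Finset.sum_coe_sort A (fun α => μ α * Real.log (μ α) - μ α * Real.log (Real.exp 1 * c α))] at h3
      refine le_trans (le_of_eq ?_) h3
      rw [Finset.sum_filter]
      refine Finset.sum_congr rfl fun α hα => ?_
      split_ifs with hp
      · have := hμc α hα hp
        rw [Real.log_div hp.ne' (by positivity)]
        ring
      · have : μ α = 0 := le_antisymm (not_lt.1 hp) (hμ0 α hα)
        simp [this]
  · rintro ⟨ν, h0, h1, h2, h3⟩ y
    have e1 : ∑ α ∈ A, ν α * (∑ i, (α i - β i) * y i) = 0 := by
      simp only [Finset.mul_sum]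
      rw [Finset.sum_comm]
      refine Finset.sum_eq_zero fun i _ => ?_
      have := congrFun h1 i
      simp only [Finset.sum_apply, Pi.smul_apply, smul_eq_mul] at this
      simp only [← mul_assoc, ← Finset.sum_mul, mul_sub, Finset.sum_sub_distrib, this, sub_self,
        zero_mul]
    rw [Finset.sum_filter] at h3
    have e2 := Finset.sum_le_sum (s := A)
      (f := fun α => ν α * (∑ i, (α i - β i) * y i)
        - (if 0 < ν α then ν α * Real.log (ν α / (Real.exp 1 * c α)) else 0))
      (g := fun α => c α * Real.exp (∑ i, (α i - β i) * y i)) (fun α hα => by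
        split_ifs with hp
        · exact aux_term _ _ _ (hc α hα) hp (h2 α hα)
        · have : ν α = 0 := le_antisymm (not_lt.1 hp) (h0 α hα)
          rw [this]
          have := mul_nonneg (hc α hα) (Real.exp_pos (∑ i, (α i - β i) * y i)).le
          linarith)
    rw [Finset.sum_sub_distrib, e1] at e2
    linarith
end

section
/- Let A ⊆ ℝⁿ be a nonempty finite set and β ∈ ℕⁿ \ A having at least one odd coordinate, and let c ∈ ℝ^{A∪{β}} with c_α ≥ 0 for all α ∈ A. Then c ∈ Pᵒ(A, β) if and only if there exists ν : A → ℝ≥0 such that Σ_{α∈A} ν_α·α = (Σ_{α∈A} ν_α)·β and Σ_{α∈A, ν_α>0} ν_α·ln(ν_α/(e·c_α)) ≤ −|c_β|, where the condition fails if ν_α > 0 and c_α = 0 for some α (the relative-entropy term is then +∞). -/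
attribute [local instance] Classical.propDecidable

open Filter Topology in
theorem aux_min {ι : Type*} [Fintype ι] (n : ℕ) (a : ι → Fin n → ℝ) (c : ι → ℝ)
    (hc : ∀ j, 0 ≤ c j) (ε : ℝ) (hε : 0 < ε) :
    ∃ y : Fin n → ℝ, (∀ i, ∑ j, c j * Real.exp (∑ k, a j k * y k) * a j i = -(2 * ε * y i)) ∧
      ∑ j, c j * Real.exp (∑ k, a j k * y k) + ε * ∑ k, y k ^ 2 ≤ ∑ j, c j := by
  set F : (Fin n → ℝ) → ℝ := fun y =>
    ∑ j, c j * Real.exp (∑ k, a j k * y k) + ε * ∑ k, y k ^ 2 with hF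
  have hcont : Continuous F := by fun_prop
  have hco : Tendsto F (cocompact _) atTop := by
    have h1 : Tendsto (fun y : Fin n → ℝ => ε * ‖y‖ ^ 2) (cocompact _) atTop :=
      ((tendsto_pow_atTop two_ne_zero).comp (tendsto_norm_cocompact_atTop)).const_mul_atTop hε
    refine tendsto_atTop_mono (fun y => ?_) h1
    have h2 : 0 ≤ ∑ j, c j * Real.exp (∑ k, a j k * y k) :=
      Finset.sum_nonneg fun j _ => mul_nonneg (hc j) (Real.exp_pos _).le
    have h3 : ‖y‖ ^ 2 ≤ ∑ k, y k ^ 2 := by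
      have h0 : 0 ≤ ∑ k, y k ^ 2 := Finset.sum_nonneg fun k _ => sq_nonneg _
      have : ‖y‖ ≤ Real.sqrt (∑ k, y k ^ 2) := by
        refine (pi_norm_le_iff_of_nonneg (Real.sqrt_nonneg _)).2 fun i => ?_
        rw [Real.norm_eq_abs]
        apply Real.abs_le_sqrt
        exact Finset.single_le_sum (f := fun k => y k ^ 2) (fun k _ => sq_nonneg _)
          (Finset.mem_univ i)
      calc ‖y‖ ^ 2 ≤ Real.sqrt (∑ k, y k ^ 2) ^ 2 := by gcongr
        _ = _ := Real.sq_sqrt h0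
    have := mul_le_mul_of_nonneg_left h3 hε.le
    simp only [hF]
    linarith
  obtain ⟨y, hy⟩ := hcont.exists_forall_le hco
  refine ⟨y, fun i => ?_, ?_⟩
  · have hd : ∀ k, HasDerivAt (fun t : ℝ => y k + t * (Pi.single i 1 : Fin n → ℝ) k)
        ((Pi.single i 1 : Fin n → ℝ) k) 0 := fun k => by
      simpa using ((hasDerivAt_id (0:ℝ)).mul_const ((Pi.single i 1 : Fin n → ℝ) k)).const_add (y k)
    have hD : HasDerivAt (fun t : ℝ => F (fun k => y k + t * (Pi.single i 1 : Fin n → ℝ) k))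
        (∑ j, c j * (Real.exp (∑ k, a j k * (y k + 0 * (Pi.single i 1 : Fin n → ℝ) k)) *
            ∑ k, a j k * (Pi.single i 1 : Fin n → ℝ) k)
          + ε * ∑ k, ((2:ℕ) * (y k + 0 * (Pi.single i 1 : Fin n → ℝ) k) ^ (2-1) *
            (Pi.single i 1 : Fin n → ℝ) k)) 0 := by
      simp only [hF]
      refine HasDerivAt.add ?_ ?_
      · refine HasDerivAt.fun_sum fun j _ => ?_
        refine HasDerivAt.const_mul _ ?_
        refine HasDerivAt.exp ?_
        exact HasDerivAt.fun_sum fun k _ => (hd k).const_mul _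
      · refine HasDerivAt.const_mul _ ?_
        exact HasDerivAt.fun_sum fun k _ => (hd k).fun_pow 2
    have hmin : IsLocalMin (fun t : ℝ => F (fun k => y k + t * (Pi.single i 1 : Fin n → ℝ) k)) 0 := by
      refine Filter.Eventually.of_forall fun t => ?_
      simpa using hy _
    have h0 := hmin.hasDerivAt_eq_zero hD
    simp [Pi.single_apply] at h0
    simp only [mul_assoc] at h0 ⊢
    linarith
  · have := hy 0
    simpa [hF] using this

open Filter Topology in
theorem aux_dual {ι : Type*} [Fintype ι] (n : ℕ) (a : ι → Fin n → ℝ) (c : ι → ℝ)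
    (hc : ∀ j, 0 ≤ c j) (m : ℝ)
    (hm : ∀ y : Fin n → ℝ, m ≤ ∑ j, c j * Real.exp (∑ k, a j k * y k)) :
    ∃ ν : ι → ℝ, (∀ j, 0 ≤ ν j) ∧ (∀ i, ∑ j, ν j * a j i = 0) ∧ (∀ j, c j = 0 → ν j = 0) ∧
      ∑ j, (ν j * Real.log (ν j) - ν j - ν j * Real.log (c j)) ≤ -m := by
  set e : ℕ → ℝ := fun N => 1 / ((N:ℝ) + 1) with he
  have hepos : ∀ N, 0 < e N := fun N => by simp only [he]; positivity
  have helim : Tendsto e atTop (𝓝 0) := tendsto_one_div_add_atTop_nhds_zero_nat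
  choose y hy1 hy2 using fun N => aux_min n a c hc (e N) (hepos N)
  set ν : ℕ → ι → ℝ := fun N j => c j * Real.exp (∑ k, a j k * y N k) with hν
  have hν0 : ∀ N j, 0 ≤ ν N j := fun N j => mul_nonneg (hc j) (Real.exp_pos _).le
  have hsq : ∀ N, 0 ≤ e N * ∑ k, y N k ^ 2 := fun N =>
    mul_nonneg (hepos N).le (Finset.sum_nonneg fun k _ => sq_nonneg _)
  have hmem : ∀ N, ν N ∈ Set.Icc (0 : ι → ℝ) (fun _ => ∑ j, c j) := fun N => by
    refine ⟨fun j => hν0 N j, fun j => ?_⟩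
    have h1 : ν N j ≤ ∑ j, ν N j :=
      Finset.single_le_sum (fun j _ => hν0 N j) (Finset.mem_univ j)
    have h2 := hy2 N
    have h3 := hsq N
    simp only [hν] at h1 ⊢
    linarith
  obtain ⟨w, -, φ, hφ, hlim⟩ := isCompact_Icc.tendsto_subseq hmem
  have hlimj : ∀ j, Tendsto (fun N => ν (φ N) j) atTop (𝓝 (w j)) := fun j =>
    (tendsto_pi_nhds.1 hlim) j
  refine ⟨w, fun j => ge_of_tendsto' (hlimj j) fun N => hν0 _ j, fun i => ?_, fun j hj => ?_, ?_⟩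
  · have h1 : Tendsto (fun N => ∑ j, ν (φ N) j * a j i) atTop (𝓝 (∑ j, w j * a j i)) :=
      tendsto_finsetSum _ fun j _ => (hlimj j).mul_const _
    have h2 : Tendsto (fun N => (e N * y N i) ^ 2) atTop (𝓝 0) := by
      have h3 : Tendsto (fun N => e N * ∑ j, c j) atTop (𝓝 0) := by
        simpa using helim.mul_const (∑ j, c j)
      refine squeeze_zero (fun N => sq_nonneg _) (fun N => ?_) h3
      have h4 : y N i ^ 2 ≤ ∑ k, y N k ^ 2 :=
        Finset.single_le_sum (f := fun k => y N k ^ 2) (fun k _ => sq_nonneg _)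
          (Finset.mem_univ i)
      have h5 := mul_le_mul_of_nonneg_left h4 (hepos N).le
      have h6 : 0 ≤ ∑ j, ν N j := Finset.sum_nonneg fun j _ => hν0 N j
      have h7 : e N * y N i ^ 2 ≤ ∑ j, c j := by
        have := hy2 N
        simp only [hν] at h6
        linarith
      have := mul_le_mul_of_nonneg_left h7 (hepos N).le
      calc (e N * y N i) ^ 2 = e N * (e N * y N i ^ 2) := by ring
        _ ≤ _ := this
    have h8 : Tendsto (fun N => (∑ j, ν (φ N) j * a j i) ^ 2) atTop (𝓝 0) := by
      have := (h2.comp hφ.tendsto_atTop).const_mul 4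
      simp only [mul_zero] at this
      refine this.congr fun N => ?_
      simp only [hν, hy1, Function.comp]
      ring
    have h9 := tendsto_nhds_unique (h1.pow 2) h8
    exact pow_eq_zero_iff two_ne_zero |>.1 h9
  · refine tendsto_nhds_unique (hlimj j) ?_
    simp [hν, hj]
  · have h1 : Tendsto (fun N => ∑ j, (ν (φ N) j * Real.log (ν (φ N) j) - ν (φ N) j
        - ν (φ N) j * Real.log (c j))) atTop
        (𝓝 (∑ j, (w j * Real.log (w j) - w j - w j * Real.log (c j)))) := by
      refine tendsto_finsetSum _ fun j _ => ?_
      refine ((((Real.continuous_mul_log.tendsto (w j)).comp (hlimj j))).sub (hlimj j)).sub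
        ((hlimj j).mul_const _)
    refine le_of_tendsto' h1 fun N => ?_
    generalize φ N = M
    have h2 : ∀ j, ν M j * Real.log (ν M j) - ν M j - ν M j * Real.log (c j)
        = ν M j * (∑ k, a j k * y M k) - ν M j := fun j => by
      rcases (hc j).eq_or_lt with h | h
      · have : ν M j = 0 := by simp [hν, ← h]
        simp [this]
      · have : Real.log (ν M j) = Real.log (c j) + ∑ k, a j k * y M k := by
          simp only [hν]
          rw [Real.log_mul h.ne' (Real.exp_pos _).ne', Real.log_exp]
        rw [this]; ring
    have h3 : ∑ j, ν M j * (∑ k, a j k * y M k) = -(2 * (e M * ∑ k, y M k ^ 2)) := by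
      simp only [Finset.mul_sum]
      rw [Finset.sum_comm, ← Finset.sum_neg_distrib]
      refine Finset.sum_congr rfl fun k _ => ?_
      have := hy1 M k
      calc ∑ j, ν M j * (a j k * y M k) = (∑ j, ν M j * a j k) * y M k := by
            rw [Finset.sum_mul]; exact Finset.sum_congr rfl fun j _ => by ring
        _ = _ := by rw [this]; ring
    simp only [h2, Finset.sum_sub_distrib, h3]
    have := hm (y M)
    have := hsq M
    simp only [hν]
    linarith

theorem aux_young (ν c t : ℝ) (hν : 0 < ν) (hc : 0 < c) :
    ν * t - ν * Real.log (ν / (Real.exp 1 * c)) ≤ c * Real.exp t := by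
  have h1 : Real.log (ν / (Real.exp 1 * c)) = Real.log ν - 1 - Real.log c := by
    rw [Real.log_div hν.ne' (by positivity), Real.log_mul (by positivity) hc.ne', Real.log_exp]
    ring
  have h2 := Real.add_one_le_exp (t + Real.log c - Real.log ν)
  rw [Real.exp_sub, Real.exp_add, Real.exp_log hc, Real.exp_log hν, le_div_iff₀ hν] at h2
  rw [h1]
  linarith

/-- Monomials in exponential coordinates. -/
theorem aux_mono (n : ℕ) (x : Fin n → ℝ) (hx : ∀ i, x i ≠ 0) (α : Fin n → ℝ) :
    ∏ i, |x i| ^ (α i) = Real.exp (∑ i, α i * Real.log |x i|) := by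
  rw [Real.exp_sum]
  refine Finset.prod_congr rfl fun i _ => ?_
  rw [Real.rpow_def_of_pos (abs_pos.2 (hx i)), mul_comm]

/-- Relative-entropy characterization of membership in the cone `Pᵒ(A, β)` of
nonnegative odd AG functions. -/
theorem stmt3 (n : ℕ) (A : Finset (Fin n → ℝ)) (hA : A.Nonempty)
    (β : Fin n → ℕ) (hβ : (fun i => (β i : ℝ)) ∉ A) (hodd : ∃ i, Odd (β i))
    (c : (Fin n → ℝ) → ℝ) (hc : ∀ α ∈ A, 0 ≤ c α) :
    (∀ x : Fin n → ℝ, (∀ i, x i ≠ 0) →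
        0 ≤ ∑ α ∈ A, c α * ∏ i, |x i| ^ (α i)
              + c (fun i => (β i : ℝ)) * ∏ i, x i ^ (β i))
      ↔ ∃ ν : (Fin n → ℝ) → ℝ,
          (∀ α ∈ A, 0 ≤ ν α) ∧
          (∑ α ∈ A, ν α • α) = (∑ α ∈ A, ν α) • (fun i => (β i : ℝ)) ∧
          (∀ α ∈ A, 0 < ν α → 0 < c α) ∧
          ∑ α ∈ A.filter (fun α => 0 < ν α),
              ν α * Real.log (ν α / (Real.exp 1 * c α))
            ≤ -|c (fun i => (β i : ℝ))| := by
  set b : Fin n → ℝ := fun i => (β i : ℝ) with hb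
  have habs : ∀ x : Fin n → ℝ, (∀ i, x i ≠ 0) →
      |∏ i, x i ^ (β i)| = Real.exp (∑ i, b i * Real.log |x i|) := fun x hx => by
    rw [← aux_mono n x hx, Finset.abs_prod]
    refine Finset.prod_congr rfl fun i _ => ?_
    simp [hb, abs_pow]
  have hsplit : ∀ (α y : Fin n → ℝ), Real.exp (∑ i, α i * y i)
      = Real.exp (∑ i, (α i - b i) * y i) * Real.exp (∑ i, b i * y i) := fun α y => by
    rw [← Real.exp_add, ← Finset.sum_add_distrib]
    congr 1
    exact Finset.sum_congr rfl fun i _ => by ring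
  constructor
  · intro H
    have key : ∀ y : Fin n → ℝ, |c b| ≤ ∑ j : A, c j * Real.exp (∑ k, ((j:Fin n → ℝ) k - b k) * y k) := by
      intro y
      obtain ⟨i₀, hi₀⟩ := hodd
      have hex : ∃ x : Fin n → ℝ, (∀ i, |x i| = Real.exp (y i)) ∧
          c b * ∏ i, x i ^ (β i) = -(|c b| * |∏ i, x i ^ (β i)|) := by
        have hpos : 0 < ∏ i, Real.exp (y i) ^ (β i) := Finset.prod_pos fun i _ => by positivity
        rcases le_total (c b) 0 with h | h
        · refine ⟨fun i => Real.exp (y i), fun i => abs_of_pos (Real.exp_pos _), ?_⟩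
          rw [abs_of_pos hpos, abs_of_nonpos h]; ring
        · refine ⟨fun i => if i = i₀ then -Real.exp (y i) else Real.exp (y i), fun i => ?_, ?_⟩
          · dsimp only
            split_ifs <;> simp
          · have : ∏ i, (if i = i₀ then -Real.exp (y i) else Real.exp (y i)) ^ (β i)
                = -∏ i, Real.exp (y i) ^ (β i) := by
              rw [← Finset.mul_prod_erase _ _ (Finset.mem_univ i₀),
                ← Finset.mul_prod_erase _ (fun i => Real.exp (y i) ^ (β i)) (Finset.mem_univ i₀)]
              rw [if_pos rfl, hi₀.neg_pow, neg_mul]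
              congr 2
              refine Finset.prod_congr rfl fun i hi => ?_
              rw [if_neg (Finset.ne_of_mem_erase hi)]
            rw [this, abs_neg, abs_of_pos hpos, abs_of_nonneg h]; ring
      obtain ⟨x, hx1, hx2⟩ := hex
      have hx : ∀ i, x i ≠ 0 := fun i => abs_pos.1 (by rw [hx1]; exact Real.exp_pos _)
      have h := H x hx
      rw [hx2, habs x hx] at h
      simp only [aux_mono n x hx] at h
      simp only [hx1, Real.log_exp] at h
      have h2 : ∑ α ∈ A, c α * Real.exp (∑ i, α i * y i)
          = (∑ α ∈ A, c α * Real.exp (∑ i, (α i - b i) * y i)) * Real.exp (∑ i, b i * y i) := by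
        rw [Finset.sum_mul]
        exact Finset.sum_congr rfl fun α _ => by rw [hsplit α y]; ring
      rw [h2] at h
      rw [Finset.sum_coe_sort A (fun α => c α * Real.exp (∑ k, (α k - b k) * y k))]
      have h3 := Real.exp_pos (∑ i, b i * y i)
      by_contra hlt
      push Not at hlt
      have := mul_lt_mul_of_pos_right hlt h3
      linarith
    obtain ⟨w, hw0, hw1, hw2, hw3⟩ := aux_dual n (fun j : A => fun k => (j:Fin n → ℝ) k - b k)
      (fun j : A => c j) (fun j => hc j j.2) |c b| key
    set ν : (Fin n → ℝ) → ℝ := fun α => if h : α ∈ A then w ⟨α, h⟩ else 0 with hν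
    have hνw : ∀ j : A, ν j = w j := fun j => by simp [hν]
    have hpos : ∀ α ∈ A, 0 < ν α → 0 < c α := fun α hα hp => by
      refine (hc α hα).lt_of_ne fun h0 => ?_
      have := hw2 ⟨α, hα⟩ h0.symm
      rw [← hνw] at this
      exact hp.ne' this
    have hnn : ∀ α ∈ A, 0 ≤ ν α := fun α hα => by rw [hνw ⟨α, hα⟩]; exact hw0 _
    refine ⟨ν, hnn, ?_, hpos, ?_⟩
    · ext i
      have h := hw1 i
      simp only [← hνw] at h
      rw [Finset.sum_coe_sort A (fun α => ν α * (α i - b i))] at h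
      simp only [mul_sub, Finset.sum_sub_distrib, ← Finset.sum_mul] at h
      simp only [Finset.sum_apply, Pi.smul_apply, smul_eq_mul]
      linarith
    · simp only [← hνw] at hw3
      rw [Finset.sum_coe_sort A (fun α => ν α * Real.log (ν α) - ν α - ν α * Real.log (c α))] at hw3
      refine le_trans (le_of_eq ?_) hw3
      rw [Finset.sum_filter]
      refine Finset.sum_congr rfl fun α hα => ?_
      split_ifs with h
      · have hcp := hpos α hα h
        rw [Real.log_div h.ne' (by positivity), Real.log_mul (by positivity) hcp.ne', Real.log_exp]
        ring
      · have : ν α = 0 := le_antisymm (not_lt.1 h) (hnn α hα)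
        simp [this]
  · rintro ⟨ν, hnn, hsum, hpos, hent⟩ x hx
    set y : Fin n → ℝ := fun i => Real.log |x i| with hy
    have h1 : ∑ α ∈ A, ν α * (∑ i, (α i - b i) * y i) = 0 := by
      simp only [Finset.mul_sum]
      rw [Finset.sum_comm]
      refine Finset.sum_eq_zero fun i _ => ?_
      have h := congrFun hsum i
      simp only [Finset.sum_apply, Pi.smul_apply, smul_eq_mul] at h
      have : ∑ α ∈ A, ν α * ((α i - b i) * y i)
          = (∑ α ∈ A, ν α * α i - (∑ α ∈ A, ν α) * b i) * y i := by
        rw [Finset.sum_mul, ← Finset.sum_sub_distrib, Finset.sum_mul]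
        exact Finset.sum_congr rfl fun α _ => by ring
      rw [this, h]; ring
    have h2 : ∑ α ∈ A, (ν α * (∑ i, (α i - b i) * y i) -
        if 0 < ν α then ν α * Real.log (ν α / (Real.exp 1 * c α)) else 0)
        ≤ ∑ α ∈ A, c α * Real.exp (∑ i, (α i - b i) * y i) := by
      refine Finset.sum_le_sum fun α hα => ?_
      split_ifs with h
      · exact aux_young _ _ _ h (hpos α hα h)
      · have : ν α = 0 := le_antisymm (not_lt.1 h) (hnn α hα)
        simp only [this, zero_mul, sub_zero]
        exact mul_nonneg (hc α hα) (Real.exp_pos _).le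
    rw [Finset.sum_sub_distrib, h1, ← Finset.sum_filter] at h2
    have h3 : |c b| ≤ ∑ α ∈ A, c α * Real.exp (∑ i, (α i - b i) * y i) := by linarith
    have h4 := mul_le_mul_of_nonneg_right h3 (Real.exp_pos (∑ i, b i * y i)).le
    have h5 := neg_abs_le (c b * ∏ i, x i ^ (β i))
    rw [abs_mul, habs x hx] at h5
    have h6 : ∑ α ∈ A, c α * ∏ i, |x i| ^ (α i)
        = (∑ α ∈ A, c α * Real.exp (∑ i, (α i - b i) * y i)) * Real.exp (∑ i, b i * y i) := by
      rw [Finset.sum_mul]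
      exact Finset.sum_congr rfl fun α _ => by
        rw [aux_mono n x hx, hsplit α (fun i => Real.log |x i|)]; ring
    rw [h6]
    linarith
end

section
/- Let ∅ ≠ A ⊆ ℝⁿ and B ⊆ ℕⁿ \ (2ℕ)ⁿ be disjoint finite sets. A coefficient vector (c, d) ∈ ℝ^A × ℝ^B lies in the S-cone C_S(A, B) if and only if (c, −|d|) ∈ C_SAGE(A ∪ B), where |d| denotes the componentwise absolute value of d. -/
attribute [local instance] Classical.propDecidable

noncomputable section

/-- Embedding of exponent vectors with natural entries into `ℝⁿ`. -/
def natEmb (n : ℕ) (β : Fin n → ℕ) : Fin n → ℝ := fun i => (β i : ℝ)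

/-- `(c, d)` is the coefficient vector of a nonnegative AG function supported on `(A, B)`:
either an even AG function (all `d` vanish and at most one `c_α` is negative) or an odd AG
function (`c ≥ 0` and at most one `d_β` nonzero), which is nonnegative on all points of `ℝⁿ`
with nonzero coordinates. -/
def IsNonnegAG (n : ℕ) (A : Finset (Fin n → ℝ)) (B : Finset (Fin n → ℕ))
    (c : (Fin n → ℝ) → ℝ) (d : (Fin n → ℕ) → ℝ) : Prop :=
  (((∀ β ∈ B, d β = 0) ∧ (A.filter fun α => c α < 0).card ≤ 1) ∨
      ((∀ α ∈ A, 0 ≤ c α) ∧ (B.filter fun β => d β ≠ 0).card ≤ 1)) ∧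
    ∀ x : Fin n → ℝ, (∀ i, x i ≠ 0) →
      0 ≤ ∑ α ∈ A, c α * ∏ i, |x i| ^ (α i)
            + ∑ β ∈ B, d β * ∏ i, (x i) ^ (β i)

/-- Membership in the S-cone `C_S(A, B)` (as a statement about the values of the
coefficient vector `(c, d) ∈ ℝ^A × ℝ^B`): the vector is a finite nonnegative combination of
coefficient vectors of nonnegative AG functions. -/
def InSCone (n : ℕ) (A : Finset (Fin n → ℝ)) (B : Finset (Fin n → ℕ))
    (c : (Fin n → ℝ) → ℝ) (d : (Fin n → ℕ) → ℝ) : Prop :=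
  ∃ (k : ℕ) (cs : Fin k → ((Fin n → ℝ) → ℝ)) (ds : Fin k → ((Fin n → ℕ) → ℝ))
      (t : Fin k → ℝ),
    (∀ j, 0 ≤ t j ∧ IsNonnegAG n A B (cs j) (ds j)) ∧
    (∀ α ∈ A, c α = ∑ j, t j * cs j α) ∧
    (∀ β ∈ B, d β = ∑ j, t j * ds j β)

/-- Membership in `C_AGE(T \ {β}, β) ⊆ ℝ^T`. -/
def InAGE (n : ℕ) (T : Finset (Fin n → ℝ)) (β : Fin n → ℝ) (v : (Fin n → ℝ) → ℝ) : Prop :=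
  (∀ α ∈ T, α ≠ β → 0 ≤ v α) ∧
    ∀ y : Fin n → ℝ, 0 ≤ ∑ α ∈ T, v α * Real.exp (∑ i, α i * y i)

/-- Membership in the SAGE cone `C_SAGE(T) = Σ_{β ∈ T} C_AGE(T \ {β}, β) ⊆ ℝ^T`. -/
def InSAGE (n : ℕ) (T : Finset (Fin n → ℝ)) (v : (Fin n → ℝ) → ℝ) : Prop :=
  ∃ w : (Fin n → ℝ) → (Fin n → ℝ) → ℝ,
    (∀ β ∈ T, InAGE n T β (w β)) ∧ ∀ α ∈ T, v α = ∑ β ∈ T, w β α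

lemma natEmb_inj (n : ℕ) {a b : Fin n → ℕ} (h : natEmb n a = natEmb n b) : a = b := by
  funext i
  have := congrFun h i
  simpa [natEmb] using this

/-- The vector `(c, -|d|)` on `A ∪ B`. -/
def vecV (n : ℕ) (A : Finset (Fin n → ℝ)) (B : Finset (Fin n → ℕ))
    (c : (Fin n → ℝ) → ℝ) (d : (Fin n → ℕ) → ℝ) : (Fin n → ℝ) → ℝ :=
  fun γ => if γ ∈ A then c γ else ∑ β ∈ B.filter (fun β => natEmb n β = γ), -|d β|

lemma vecV_A {n : ℕ} {A : Finset (Fin n → ℝ)} {B : Finset (Fin n → ℕ)}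
    {c : (Fin n → ℝ) → ℝ} {d : (Fin n → ℕ) → ℝ} {α : Fin n → ℝ} (h : α ∈ A) :
    vecV n A B c d α = c α := by
  simp [vecV, h]

lemma vecV_B {n : ℕ} {A : Finset (Fin n → ℝ)} {B : Finset (Fin n → ℕ)}
    (hdisj : ∀ β ∈ B, natEmb n β ∉ A)
    {c : (Fin n → ℝ) → ℝ} {d : (Fin n → ℕ) → ℝ} {β : Fin n → ℕ} (h : β ∈ B) :
    vecV n A B c d (natEmb n β) = -|d β| := by
  have h2 : B.filter (fun b => natEmb n b = natEmb n β) = {β} := by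
    ext b
    simp only [Finset.mem_filter, Finset.mem_singleton]
    constructor
    · rintro ⟨_, h⟩
      exact natEmb_inj n h
    · rintro rfl
      exact ⟨h, rfl⟩
  simp only [vecV, hdisj β h, if_false]
  rw [h2, Finset.sum_singleton]

lemma sum_T {n : ℕ} {A : Finset (Fin n → ℝ)} {B : Finset (Fin n → ℕ)}
    (hdisj : ∀ β ∈ B, natEmb n β ∉ A) (f : (Fin n → ℝ) → ℝ) :
    ∑ γ ∈ A ∪ B.image (natEmb n), f γ = ∑ α ∈ A, f α + ∑ β ∈ B, f (natEmb n β) := by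
  rw [Finset.sum_union, Finset.sum_image]
  · intro a _ b _ h
    exact natEmb_inj n h
  · rw [Finset.disjoint_right]
    intro γ hγ
    obtain ⟨β, hβ, rfl⟩ := Finset.mem_image.1 hγ
    exact hdisj β hβ

lemma InSAGE.congr {n : ℕ} {T : Finset (Fin n → ℝ)} {v v' : (Fin n → ℝ) → ℝ}
    (h : InSAGE n T v) (e : ∀ α ∈ T, v' α = v α) : InSAGE n T v' := by
  obtain ⟨w, hw, hs⟩ := h
  exact ⟨w, hw, fun α hα => (e α hα).trans (hs α hα)⟩

lemma InAGE.zero {n : ℕ} {T : Finset (Fin n → ℝ)} {β : Fin n → ℝ} :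
    InAGE n T β (fun _ => 0) := ⟨fun _ _ _ => le_rfl, fun y => by simp⟩

lemma InAGE.add {n : ℕ} {T : Finset (Fin n → ℝ)} {β : Fin n → ℝ} {v v' : (Fin n → ℝ) → ℝ}
    (h : InAGE n T β v) (h' : InAGE n T β v') : InAGE n T β (fun α => v α + v' α) := by
  refine ⟨fun α hα hne => add_nonneg (h.1 α hα hne) (h'.1 α hα hne), fun y => ?_⟩
  simp only [add_mul, Finset.sum_add_distrib]
  exact add_nonneg (h.2 y) (h'.2 y)

lemma InAGE.smul {n : ℕ} {T : Finset (Fin n → ℝ)} {β : Fin n → ℝ} {v : (Fin n → ℝ) → ℝ}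
    (h : InAGE n T β v) {t : ℝ} (ht : 0 ≤ t) : InAGE n T β (fun α => t * v α) := by
  refine ⟨fun α hα hne => mul_nonneg ht (h.1 α hα hne), fun y => ?_⟩
  simp only [mul_assoc, ← Finset.mul_sum]
  exact mul_nonneg ht (h.2 y)

lemma InAGE.sage {n : ℕ} {T : Finset (Fin n → ℝ)} {β : Fin n → ℝ} {v : (Fin n → ℝ) → ℝ}
    (hβ : β ∈ T) (h : InAGE n T β v) : InSAGE n T v := by
  refine ⟨fun b => if b = β then v else fun _ => 0, ?_, ?_⟩
  · intro b hb
    by_cases e : b = β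
    · subst e
      simpa using h
    · simp only [e, if_false]
      exact InAGE.zero
  · intro α hα
    rw [Finset.sum_eq_single β]
    · simp
    · intro b _ hne
      simp [hne]
    · exact fun h => absurd hβ h

lemma InSAGE.add {n : ℕ} {T : Finset (Fin n → ℝ)} {v v' : (Fin n → ℝ) → ℝ}
    (h : InSAGE n T v) (h' : InSAGE n T v') : InSAGE n T (fun α => v α + v' α) := by
  obtain ⟨w, hw, hs⟩ := h
  obtain ⟨w', hw', hs'⟩ := h'
  refine ⟨fun β α => w β α + w' β α, fun β hβ => (hw β hβ).add (hw' β hβ), fun α hα => ?_⟩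
  simp only [Finset.sum_add_distrib, hs α hα, hs' α hα]

lemma InSAGE.smul {n : ℕ} {T : Finset (Fin n → ℝ)} {v : (Fin n → ℝ) → ℝ}
    (h : InSAGE n T v) {t : ℝ} (ht : 0 ≤ t) : InSAGE n T (fun α => t * v α) := by
  obtain ⟨w, hw, hs⟩ := h
  refine ⟨fun β α => t * w β α, fun β hβ => (hw β hβ).smul ht, fun α hα => ?_⟩
  simp only [← Finset.mul_sum, hs α hα]

lemma InSAGE.sum {n : ℕ} {T : Finset (Fin n → ℝ)} {ι : Type} (s : Finset ι)
    (v : ι → (Fin n → ℝ) → ℝ) (h : ∀ j, InSAGE n T (v j)) :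
    InSAGE n T (fun α => ∑ j ∈ s, v j α) := by
  induction s using Finset.induction_on with
  | empty => exact ⟨fun _ _ => 0, fun _ _ => InAGE.zero, fun _ _ => by simp⟩
  | insert a s ha ih => exact ((h a).add ih).congr fun α _ => Finset.sum_insert ha

/-- Elimination of cancellation in a SAGE decomposition. -/
lemma elim {n : ℕ} {T : Finset (Fin n → ℝ)} {v : (Fin n → ℝ) → ℝ} (h : InSAGE n T v)
    (S : Finset (Fin n → ℝ)) (hST : S ⊆ T) (hv : ∀ γ ∈ S, v γ ≤ 0) :
    ∃ w : (Fin n → ℝ) → (Fin n → ℝ) → ℝ,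
      (∀ β ∈ T, InAGE n T β (w β)) ∧ (∀ α ∈ T, v α = ∑ β ∈ T, w β α) ∧
      ∀ γ ∈ S, ∀ β ∈ T, β ≠ γ → w β γ = 0 := by
  induction S using Finset.induction_on with
  | empty =>
    obtain ⟨w, hw, hs⟩ := h
    exact ⟨w, hw, hs, by simp⟩
  | insert γ S hγ ih =>
    obtain ⟨w, hw, hs, hz⟩ := ih (fun x hx => hST (Finset.mem_insert_of_mem hx))
      (fun x hx => hv x (Finset.mem_insert_of_mem hx))
    have hγT : γ ∈ T := hST (Finset.mem_insert_self _ _)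
    have hvγ : v γ ≤ 0 := hv γ (Finset.mem_insert_self _ _)
    have hnn : ∀ β ∈ T.erase γ, 0 ≤ w β γ := fun β hβ =>
      (hw β (Finset.mem_of_mem_erase hβ)).1 γ hγT (Finset.ne_of_mem_erase hβ).symm
    have hsum : v γ = w γ γ + ∑ β ∈ T.erase γ, w β γ := by
      rw [hs γ hγT, Finset.add_sum_erase T (fun β => w β γ) hγT]
    have hsn := Finset.sum_nonneg hnn
    obtain ⟨l, hl0, hl, hl1⟩ : ∃ l : (Fin n → ℝ) → ℝ, (∀ β ∈ T.erase γ, 0 ≤ l β) ∧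
        (∀ β ∈ T.erase γ, w β γ + l β * w γ γ = 0) ∧ ∑ β ∈ T.erase γ, l β ≤ 1 := by
      by_cases ha : w γ γ = 0
      · have h0 : ∑ β ∈ T.erase γ, w β γ = 0 := by linarith
        have := (Finset.sum_eq_zero_iff_of_nonneg hnn).1 h0
        exact ⟨fun _ => 0, fun _ _ => le_rfl, fun β hβ => by simp [this β hβ], by simp⟩
      · have hneg : 0 < - w γ γ := by
          rcases lt_or_gt_of_ne ha with h | h
          · linarith
          · linarith
        refine ⟨fun β => w β γ / (- w γ γ), fun β hβ => div_nonneg (hnn β hβ) hneg.le,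
          fun β hβ => by field_simp; ring, ?_⟩
        rw [← Finset.sum_div, div_le_one hneg]
        linarith
    refine ⟨fun β => if β = γ then fun α => (1 - ∑ b ∈ T.erase γ, l b) * w γ α
      else fun α => w β α + l β * w γ α, ?_, ?_, ?_⟩
    · intro β hβ
      by_cases e : β = γ
      · subst e
        simp only [if_true]
        exact (hw β hβ).smul (by linarith)
      · simp only [e, if_false]
        have hβe : β ∈ T.erase γ := Finset.mem_erase.2 ⟨e, hβ⟩
        refine ⟨fun α hα hne => ?_, fun y => ?_⟩
        · by_cases e2 : α = γ
          · subst e2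
            exact (hl β hβe).ge
          · exact add_nonneg ((hw β hβ).1 α hα hne)
              (mul_nonneg (hl0 β hβe) ((hw γ hγT).1 α hα e2))
        · simp only [add_mul, mul_assoc, Finset.sum_add_distrib, ← Finset.mul_sum]
          exact add_nonneg ((hw β hβ).2 y) (mul_nonneg (hl0 β hβe) ((hw γ hγT).2 y))
    · intro α hα
      rw [hs α hα, ← Finset.add_sum_erase T _ hγT, ← Finset.add_sum_erase T _ hγT]
      have : ∑ x ∈ T.erase γ, (if x = γ then fun α => (1 - ∑ b ∈ T.erase γ, l b) * w γ α
          else fun α => w x α + l x * w γ α) α = ∑ x ∈ T.erase γ, (w x α + l x * w γ α) :=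
        Finset.sum_congr rfl fun x hx => by simp [Finset.ne_of_mem_erase hx]
      rw [this, Finset.sum_add_distrib, ← Finset.sum_mul]
      simp only [if_true]
      ring
    · intro g hg β hβ hne
      rcases Finset.mem_insert.1 hg with rfl | hg
      · simp only [hne, if_false]
        exact hl β (Finset.mem_erase.2 ⟨hne, hβ⟩)
      · have hγg : γ ≠ g := by
          rintro rfl
          exact hγ hg
        have h0 := hz g hg γ hγT hγg
        by_cases e : β = γ
        · simp [e, h0]
        · simp [e, h0, hz g hg β hβ hne]

lemma exp_eq_prod {n : ℕ} (x : Fin n → ℝ) (hx : ∀ i, x i ≠ 0) (α : Fin n → ℝ) :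
    Real.exp (∑ i, α i * Real.log |x i|) = ∏ i, |x i| ^ (α i) := by
  rw [Real.exp_sum]
  refine Finset.prod_congr rfl fun i _ => ?_
  rw [Real.rpow_def_of_pos (abs_pos.2 (hx i)), mul_comm]

lemma exp_natEmb {n : ℕ} (x : Fin n → ℝ) (hx : ∀ i, x i ≠ 0) (β : Fin n → ℕ) :
    Real.exp (∑ i, natEmb n β i * Real.log |x i|) = |∏ i, x i ^ β i| := by
  rw [exp_eq_prod x hx, Finset.abs_prod]
  refine Finset.prod_congr rfl fun i _ => ?_
  rw [natEmb, Real.rpow_natCast, abs_pow]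

/-- For an odd exponent every point of the positive orthant has a sign flip realizing either
sign of the monomial. -/
lemma exists_flip {n : ℕ} (y : Fin n → ℝ) (β : Fin n → ℕ) (hβ : ∃ i, Odd (β i)) (r : ℝ) :
    ∃ x : Fin n → ℝ, (∀ i, x i ≠ 0) ∧ (∀ i, Real.log |x i| = y i) ∧
      r * ∏ i, x i ^ β i = -|r| * |∏ i, x i ^ β i| := by
  have hex : ∀ i, Real.exp (y i) ≠ 0 := fun i => (Real.exp_pos _).ne'
  have hpos : 0 < ∏ i, Real.exp (y i) ^ β i :=
    Finset.prod_pos fun i _ => pow_pos (Real.exp_pos _) _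
  rcases le_total r 0 with hr | hr
  · refine ⟨fun i => Real.exp (y i), hex, fun i => by simp, ?_⟩
    rw [abs_of_nonpos hr, abs_of_pos hpos]
    ring
  · obtain ⟨i0, hi0⟩ := hβ
    have hp : ∏ i, (if i = i0 then -Real.exp (y i) else Real.exp (y i)) ^ β i =
        -∏ i, Real.exp (y i) ^ β i := by
      rw [← Finset.mul_prod_erase Finset.univ _ (Finset.mem_univ i0),
        ← Finset.mul_prod_erase Finset.univ (fun i => Real.exp (y i) ^ β i)
          (Finset.mem_univ i0)]
      simp only [if_true, hi0.neg_pow, neg_mul]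
      congr 2
      exact Finset.prod_congr rfl fun i hi => by simp [Finset.ne_of_mem_erase hi]
    refine ⟨fun i => if i = i0 then -Real.exp (y i) else Real.exp (y i), ?_, ?_, ?_⟩
    · intro i
      by_cases e : i = i0 <;> simp [e]
    · intro i
      by_cases e : i = i0 <;> simp [e]
    · rw [hp, abs_neg, abs_of_nonneg hr, abs_of_pos hpos]
      ring

lemma sage_of_AG {n : ℕ} {A : Finset (Fin n → ℝ)} (hA : A.Nonempty)
    {B : Finset (Fin n → ℕ)} (hBodd : ∀ β ∈ B, ∃ i, Odd (β i))
    (hdisj : ∀ β ∈ B, natEmb n β ∉ A)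
    {c : (Fin n → ℝ) → ℝ} {d : (Fin n → ℕ) → ℝ} (h : IsNonnegAG n A B c d) :
    InSAGE n (A ∪ B.image (natEmb n)) (vecV n A B c d) := by
  obtain ⟨h1, hpos⟩ := h
  have key : ∀ y : Fin n → ℝ, (∃ x : Fin n → ℝ, (∀ i, x i ≠ 0) ∧
      (∀ i, Real.log |x i| = y i) ∧
      ∀ β ∈ B, d β * ∏ i, x i ^ β i = -|d β| * |∏ i, x i ^ β i|) →
      0 ≤ ∑ α ∈ A ∪ B.image (natEmb n), vecV n A B c d α * Real.exp (∑ i, α i * y i) := by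
    rintro y ⟨x, hx, hxy, hB⟩
    have := hpos x hx
    rw [sum_T hdisj]
    convert this using 2
    · refine Finset.sum_congr rfl fun α hα => ?_
      rw [vecV_A hα, ← exp_eq_prod x hx]
      simp only [hxy]
    · refine Finset.sum_congr rfl fun β hβ => ?_
      rw [vecV_B hdisj hβ, hB β hβ, ← exp_natEmb x hx]
      simp only [hxy]
  obtain ⟨α0, hα0⟩ := hA
  have posx : ∀ y : Fin n → ℝ, (∀ β ∈ B, d β = 0) → (∃ x : Fin n → ℝ, (∀ i, x i ≠ 0) ∧
      (∀ i, Real.log |x i| = y i) ∧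
      ∀ β ∈ B, d β * ∏ i, x i ^ β i = -|d β| * |∏ i, x i ^ β i|) := fun y hd =>
    ⟨fun i => Real.exp (y i), fun i => (Real.exp_pos _).ne', fun i => by simp,
      fun β hβ => by simp [hd β hβ]⟩
  rcases h1 with ⟨hd, hc⟩ | ⟨hc, hd⟩
  · obtain ⟨a, ha, hane⟩ : ∃ a ∈ A, ∀ α ∈ A, α ≠ a → 0 ≤ c α := by
      by_cases hneg : ∃ a ∈ A, c a < 0
      · obtain ⟨a, ha, hca⟩ := hneg
        refine ⟨a, ha, fun α hα hne => ?_⟩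
        by_contra hlt
        exact hne (Finset.card_le_one.1 hc α (by simpa [hα] using hlt) a (by simp [ha, hca]))
      · push Not at hneg
        exact ⟨α0, hα0, fun α hα _ => hneg α hα⟩
    refine InAGE.sage (β := a) (Finset.mem_union_left _ ha) ⟨?_, fun y => key y (posx y hd)⟩
    intro γ hγ hne
    rcases Finset.mem_union.1 hγ with hγ | hγ
    · rw [vecV_A hγ]
      exact hane γ hγ hne
    · obtain ⟨β, hβ, rfl⟩ := Finset.mem_image.1 hγ
      rw [vecV_B hdisj hβ, hd β hβ]
      simp
  · by_cases hnz : ∃ b ∈ B, d b ≠ 0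
    · obtain ⟨b, hb, hdb⟩ := hnz
      have huniq : ∀ β ∈ B, β ≠ b → d β = 0 := by
        intro β hβ hne
        by_contra h0
        exact hne (Finset.card_le_one.1 hd β (by simp [hβ, h0]) b (by simp [hb, hdb]))
      refine InAGE.sage (β := natEmb n b)
        (Finset.mem_union_right _ (Finset.mem_image_of_mem _ hb)) ⟨?_, fun y => key y ?_⟩
      · intro γ hγ hne
        rcases Finset.mem_union.1 hγ with hγ | hγ
        · rw [vecV_A hγ]
          exact hc γ hγ
        · obtain ⟨β, hβ, rfl⟩ := Finset.mem_image.1 hγ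
          rw [vecV_B hdisj hβ, huniq β hβ (fun e => hne (by rw [e]))]
          simp
      · obtain ⟨x, hx, hxy, hr⟩ := exists_flip y b (hBodd b hb) (d b)
        refine ⟨x, hx, hxy, fun β hβ => ?_⟩
        by_cases e : β = b
        · rw [e, hr]
        · simp [huniq β hβ e]
    · push Not at hnz
      refine InAGE.sage (β := α0) (Finset.mem_union_left _ hα0)
        ⟨?_, fun y => key y (posx y hnz)⟩
      intro γ hγ hne
      rcases Finset.mem_union.1 hγ with hγ | hγ
      · rw [vecV_A hγ]
        exact hc γ hγ
      · obtain ⟨β, hβ, rfl⟩ := Finset.mem_image.1 hγ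
        rw [vecV_B hdisj hβ, hnz β hβ]
        simp

/-- `(c, d)` lies in the S-cone `C_S(A, B)` iff `(c, −|d|)` lies in `C_SAGE(A ∪ B)`. -/
theorem stmt5 (n : ℕ) (A : Finset (Fin n → ℝ)) (hA : A.Nonempty)
    (B : Finset (Fin n → ℕ)) (hBodd : ∀ β ∈ B, ∃ i, Odd (β i))
    (hdisj : ∀ β ∈ B, natEmb n β ∉ A)
    (c : (Fin n → ℝ) → ℝ) (d : (Fin n → ℕ) → ℝ) :
    InSCone n A B c d ↔
      InSAGE n (A ∪ B.image (natEmb n))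
        (fun γ => if γ ∈ A then c γ
          else ∑ β ∈ B.filter (fun β => natEmb n β = γ), -|d β|) := by
  change InSCone n A B c d ↔ InSAGE n (A ∪ B.image (natEmb n)) (vecV n A B c d)
  constructor
  · rintro ⟨k, cs, ds, t, h, hc, hd⟩
    obtain ⟨α0, hα0⟩ := hA
    have h1 : InSAGE n (A ∪ B.image (natEmb n))
        (fun γ => ∑ j, t j * vecV n A B (cs j) (ds j) γ) :=
      InSAGE.sum Finset.univ (fun j γ => t j * vecV n A B (cs j) (ds j) γ)
        fun j => (sage_of_AG ⟨α0, hα0⟩ hBodd hdisj (h j).2).smul (h j).1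
    have hu : ∀ γ ∈ A ∪ B.image (natEmb n),
        0 ≤ vecV n A B c d γ - ∑ j, t j * vecV n A B (cs j) (ds j) γ := by
      intro γ hγ
      rcases Finset.mem_union.1 hγ with hγ | hγ
      · simp only [vecV_A hγ, hc γ hγ, sub_self, le_refl]
      · obtain ⟨β, hβ, rfl⟩ := Finset.mem_image.1 hγ
        simp only [vecV_B hdisj hβ, mul_neg, Finset.sum_neg_distrib]
        have : |d β| ≤ ∑ j, t j * |ds j β| := by
          rw [hd β hβ]
          refine (Finset.abs_sum_le_sum_abs _ _).trans_eq ?_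
          exact Finset.sum_congr rfl fun j _ => by rw [abs_mul, abs_of_nonneg (h j).1]
        linarith
    have h2 : InSAGE n (A ∪ B.image (natEmb n))
        (fun γ => vecV n A B c d γ - ∑ j, t j * vecV n A B (cs j) (ds j) γ) :=
      InAGE.sage (β := α0) (Finset.mem_union_left _ hα0)
        ⟨fun γ hγ _ => hu γ hγ, fun y => Finset.sum_nonneg fun γ hγ =>
          mul_nonneg (hu γ hγ) (Real.exp_pos _).le⟩
    exact (h1.add h2).congr fun γ _ => by ring
  · intro h
    obtain ⟨w, hw, hs, hz⟩ := elim h (B.image (natEmb n)) Finset.subset_union_right (by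
      intro γ hγ
      obtain ⟨β, hβ, rfl⟩ := Finset.mem_image.1 hγ
      rw [vecV_B hdisj hβ]
      simp)
    have hBT : ∀ β ∈ B, natEmb n β ∈ A ∪ B.image (natEmb n) := fun β hβ =>
      Finset.mem_union_right _ (Finset.mem_image_of_mem _ hβ)
    have hwd : ∀ β ∈ B, w (natEmb n β) (natEmb n β) = -|d β| := by
      intro β hβ
      have := hs _ (hBT β hβ)
      rw [vecV_B hdisj hβ, Finset.sum_eq_single (natEmb n β)] at this
      · exact this.symm
      · exact fun b hb hne => hz _ (Finset.mem_image_of_mem _ hβ) b hb hne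
      · exact fun hn => absurd (hBT β hβ) hn
    set T := A ∪ B.image (natEmb n) with hT
    have hsumT : ∀ f : (Fin n → ℝ) → ℝ,
        ∑ j : Fin T.card, f (T.equivFin.symm j) = ∑ γ ∈ T, f γ := by
      intro f
      rw [Equiv.sum_comp T.equivFin.symm (fun γ : T => f γ), Finset.sum_coe_sort T f]
    refine ⟨T.card, fun j => w (T.equivFin.symm j),
      fun j β => if natEmb n β = (T.equivFin.symm j : Fin n → ℝ) then d β else 0,
      fun _ => 1, ?_, ?_, ?_⟩
    · intro j
      refine ⟨zero_le_one, ?_⟩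
      suffices hG : ∀ γ ∈ T, IsNonnegAG n A B (w γ)
          (fun β => if natEmb n β = γ then d β else 0) from hG _ (T.equivFin.symm j).2
      intro γ hγ
      refine ⟨?_, ?_⟩
      · by_cases hγA : γ ∈ A
        · left
          refine ⟨fun β hβ => if_neg ?_, ?_⟩
          · rintro rfl
            exact hdisj β hβ hγA
          · rw [Finset.card_le_one]
            have : ∀ a ∈ A.filter (fun α => w γ α < 0), a = γ := by
              intro a ha
              obtain ⟨ha, hlt⟩ := Finset.mem_filter.1 ha
              by_contra hne
              exact absurd ((hw γ hγ).1 a (Finset.mem_union_left _ ha) hne) (not_le.2 hlt)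
            intro a ha b hb
            rw [this a ha, this b hb]
        · right
          refine ⟨fun α hα => (hw γ hγ).1 α (Finset.mem_union_left _ hα) ?_, ?_⟩
          · rintro rfl
            exact hγA hα
          · rw [Finset.card_le_one]
            have : ∀ b ∈ B.filter (fun β => (if natEmb n β = γ then d β else 0) ≠ 0),
                natEmb n b = γ := by
              intro b hb
              by_contra hne
              exact (Finset.mem_filter.1 hb).2 (if_neg hne)
            intro a ha b hb
            exact natEmb_inj n ((this a ha).trans (this b hb).symm)
      · intro x hx
        have h0 := (hw γ hγ).2 (fun i => Real.log |x i|)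
        rw [hT, sum_T hdisj] at h0
        refine h0.trans (add_le_add (le_of_eq ?_) (Finset.sum_le_sum fun β hβ => ?_))
        · exact Finset.sum_congr rfl fun α _ => by rw [exp_eq_prod x hx]
        · rw [exp_natEmb x hx]
          beta_reduce
          by_cases e : natEmb n β = γ
          · subst e
            rw [if_pos rfl, hwd β hβ, neg_mul, ← abs_mul]
            exact neg_abs_le _
          · rw [if_neg e, hz _ (Finset.mem_image_of_mem _ hβ) γ hγ (fun e' => e e'.symm)]
            simp
    · intro α hα
      simp only [one_mul]
      rw [hsumT (fun γ => w γ α), ← hs α (Finset.mem_union_left _ hα), vecV_A hα]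
    · intro β hβ
      simp only [one_mul]
      rw [hsumT (fun γ => if natEmb n β = γ then d β else 0), Finset.sum_ite_eq,
        if_pos (hBT β hβ)]
end
end

section
/- Let ∅ ≠ 𝒜 ⊆ ℝⁿ be finite. A vector v ∈ ℝ^𝒜 lies in the dual cone C_SAGE(𝒜)* if and only if v_α ≥ 0 for all α ∈ 𝒜 and, for every circuit (A, β) with A ⊆ 𝒜 and β ∈ 𝒜 \ A and barycentric coordinates λ, one has v_β ≤ ∏_{α∈A} v_α^{λ_α} (real powers, with 0^t = 0 for t > 0). -/
attribute [local instance] Classical.propDecidable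

noncomputable section

theorem carath_aux {n : ℕ} (b : (Fin n → ℝ) → ℝ) (β : Fin n → ℝ) :
    ∀ (k : ℕ) (S : Finset (Fin n → ℝ)) (lam : (Fin n → ℝ) → ℝ), S.card = k →
      (∀ α ∈ S, 0 ≤ lam α) → (∑ α ∈ S, lam α) = 1 → (∑ α ∈ S, lam α • α) = β →
      (∑ α ∈ S, lam α * b α) ≤ 0 →
      ∃ (A : Finset (Fin n → ℝ)) (mu : (Fin n → ℝ) → ℝ), A ⊆ S ∧
        AffineIndependent ℝ (fun x : A => (x : Fin n → ℝ)) ∧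
        (∀ α ∈ A, 0 < mu α) ∧ (∑ α ∈ A, mu α) = 1 ∧ (∑ α ∈ A, mu α • α) = β ∧
        (∑ α ∈ A, mu α * b α) ≤ 0 := by
  intro k
  induction k with
  | zero =>
    intro S lam hS _ h1
    rw [Finset.card_eq_zero] at hS
    subst hS
    simp at h1
  | succ k ih =>
    intro S lam hS h0 h1 h2 h3
    -- removing a point of weight zero
    have key : ∀ (nu : (Fin n → ℝ) → ℝ) (a : Fin n → ℝ), a ∈ S → nu a = 0 →
      (∀ α ∈ S, 0 ≤ nu α) → (∑ α ∈ S, nu α) = 1 → (∑ α ∈ S, nu α • α) = β →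
      (∑ α ∈ S, nu α * b α) ≤ 0 → 
      ∃ (A : Finset (Fin n → ℝ)) (mu : (Fin n → ℝ) → ℝ), A ⊆ S ∧
        AffineIndependent ℝ (fun x : A => (x : Fin n → ℝ)) ∧
        (∀ α ∈ A, 0 < mu α) ∧ (∑ α ∈ A, mu α) = 1 ∧ (∑ α ∈ A, mu α • α) = β ∧
        (∑ α ∈ A, mu α * b α) ≤ 0 := by
      intro nu a ha hz g0 g1 g2 g3
      obtain ⟨A, mu, hA, hr⟩ := ih (S.erase a) nu (by rw [Finset.card_erase_of_mem ha]; omega)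
        (fun α hα => g0 α (Finset.mem_of_mem_erase hα))
        (by rw [Finset.sum_erase _ hz]; exact g1)
        (by rw [Finset.sum_erase _ (by rw [hz, zero_smul])]; exact g2)
        (by rw [Finset.sum_erase _ (by rw [hz, zero_mul])]; exact g3)
      exact ⟨A, mu, hA.trans (Finset.erase_subset _ _), hr⟩
    by_cases hz : ∃ a ∈ S, lam a = 0
    · obtain ⟨a, ha, hz⟩ := hz
      exact key lam a ha hz h0 h1 h2 h3
    by_cases hind : AffineIndependent ℝ (fun x : S => (x : Fin n → ℝ))
    · refine ⟨S, lam, subset_rfl, hind, ?_, h1, h2, h3⟩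
      intro α hα
      exact lt_of_le_of_ne (h0 α hα) (fun h => hz ⟨α, hα, h.symm⟩)
    obtain ⟨g, hg1, hg0, x, hx, hgx⟩ := exists_nontrivial_relation_sum_zero_of_not_affine_ind hind
    obtain ⟨g, hg1, hg0, hgx, hgb⟩ : ∃ g : (Fin n → ℝ) → ℝ, ∑ e ∈ S, g e • e = 0 ∧
        ∑ e ∈ S, g e = 0 ∧ (∃ x ∈ S, g x ≠ 0) ∧ ∑ e ∈ S, g e * b e ≤ 0 := by
      rcases le_total (∑ e ∈ S, g e * b e) 0 with h | h
      · exact ⟨g, hg1, hg0, ⟨x, hx, hgx⟩, h⟩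
      · refine ⟨fun e => - g e, ?_, ?_, ⟨x, hx, by simpa using hgx⟩, ?_⟩
        · simp [hg1]
        · simp [hg0]
        · simpa using h
    have hneg : ∃ a ∈ S, g a < 0 := by
      by_contra! hcon
      obtain ⟨x, hx, hne⟩ := hgx
      exact hne ((Finset.sum_eq_zero_iff_of_nonneg hcon).1 hg0 x hx)
    have hNe : (S.filter (fun a => g a < 0)).Nonempty := by
      obtain ⟨a, ha, h⟩ := hneg
      exact ⟨a, Finset.mem_filter.2 ⟨ha, h⟩⟩
    obtain ⟨a, ha, hmin⟩ := Finset.exists_min_image _ (fun a => lam a / (- g a)) hNe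
    rw [Finset.mem_filter] at ha
    obtain ⟨ha, hga⟩ := ha
    set t := lam a / (- g a) with ht
    have ht0 : 0 ≤ t := div_nonneg (h0 a ha) (by linarith)
    refine key (fun e => lam e + t * g e) a ha ?_ ?_ ?_ ?_ ?_
    · have hne : - g a ≠ 0 := (neg_pos.2 hga).ne'
      have h5 : t * (- g a) = lam a := div_mul_cancel₀ _ hne
      show lam a + t * g a = 0
      linarith
    · intro α hα
      by_cases hgα : g α < 0
      · have := hmin α (Finset.mem_filter.2 ⟨hα, hgα⟩)
        rw [le_div_iff₀ (by linarith)] at this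
        show 0 ≤ lam α + t * g α
        linarith
      · push Not at hgα
        have := mul_nonneg ht0 hgα
        have := h0 α hα
        show 0 ≤ lam α + t * g α
        linarith
    · rw [Finset.sum_add_distrib, ← Finset.mul_sum, hg0, h1]; simp
    · simp only [add_smul, mul_smul]
      rw [Finset.sum_add_distrib, ← Finset.smul_sum, hg1, h2]; simp
    · simp only [add_mul, mul_assoc]
      rw [Finset.sum_add_distrib, ← Finset.mul_sum]
      have := mul_nonneg_of_nonpos_of_nonpos (neg_nonpos.2 ht0) hgb
      linarith

theorem farkas_aux {n : ℕ} (b : (Fin n → ℝ) → ℝ) (β : Fin n → ℝ) (S : Finset (Fin n → ℝ))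
    (H : ∀ lam : (Fin n → ℝ) → ℝ, (∀ α ∈ S, 0 ≤ lam α) → (∑ α ∈ S, lam α) = 1 →
      (∑ α ∈ S, lam α • α) = β → 0 < ∑ α ∈ S, lam α * b α) :
    ∃ y : Fin n → ℝ, ∀ α ∈ S, ∑ i, (α i - β i) * y i < b α := by
  let L : (S → ℝ) →ₗ[ℝ] ((Fin n → ℝ) × ℝ) :=
    { toFun := fun w => (∑ a : S, w a • ((a : Fin n → ℝ) - β), ∑ a : S, w a * b a)
      map_add' := by
        intro x y
        simp [add_smul, add_mul, Finset.sum_add_distrib]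
      map_smul' := by
        intro c x
        simp [mul_smul, mul_assoc, Finset.smul_sum, Finset.mul_sum] }
  have hKc : IsCompact (L '' stdSimplex ℝ S) :=
    (isCompact_stdSimplex ℝ S).image L.continuous_of_finiteDimensional
  have hKconv : Convex ℝ (L '' stdSimplex ℝ S) := (convex_stdSimplex ℝ S).linear_image L
  have hRc : IsClosed (({0} : Set (Fin n → ℝ)) ×ˢ Set.Iic (0 : ℝ)) :=
    isClosed_singleton.prod isClosed_Iic
  have hRconv : Convex ℝ (({0} : Set (Fin n → ℝ)) ×ˢ Set.Iic (0 : ℝ)) :=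
    (convex_singleton 0).prod (convex_Iic 0)
  have hdisj : Disjoint (L '' stdSimplex ℝ S) (({0} : Set (Fin n → ℝ)) ×ˢ Set.Iic (0 : ℝ)) := by
    rw [Set.disjoint_left]
    rintro _ ⟨w, ⟨hw0, hw1⟩, rfl⟩ ⟨h1, h2⟩
    change (∑ a : S, w a • ((a : Fin n → ℝ) - β)) = 0 at h1
    change (∑ a : S, w a * b a) ≤ 0 at h2
    let lam : (Fin n → ℝ) → ℝ := fun α => if h : α ∈ S then w ⟨α, h⟩ else 0
    have hlam : ∀ a : S, lam a = w a := fun a => by simp [lam]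
    have := H lam (fun α hα => by rw [hlam ⟨α, hα⟩]; exact hw0 _)
      (by rw [← Finset.sum_coe_sort]; simpa only [hlam] using hw1)
      (by
        rw [← Finset.sum_coe_sort]
        simp only [hlam]
        simp only [smul_sub, Finset.sum_sub_distrib, ← Finset.sum_smul, hw1, one_smul] at h1
        exact sub_eq_zero.1 h1)
    rw [← Finset.sum_coe_sort] at this
    simp only [hlam] at this
    linarith
  obtain ⟨f, u, v, hfu, huv, hfv⟩ :=
    geometric_hahn_banach_compact_closed hKconv hKc hRconv hRc hdisj
  have hu0 : u < 0 := by
    have := hfv (0, 0) ⟨rfl, le_refl (0:ℝ)⟩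
    have h0 : f ((0 : Fin n → ℝ), (0:ℝ)) = 0 := map_zero f
    linarith
  set s := f (0, 1) with hs
  have hft : ∀ t : ℝ, f (0, t) = t * s := by
    intro t
    have : ((0 : Fin n → ℝ), t) = t • ((0 : Fin n → ℝ), (1:ℝ)) := by simp
    rw [this, map_smul]; rfl
  have hs0 : s ≤ 0 := by
    by_contra! hpos
    have := hfv (0, v / s - 0) ⟨rfl, ?_⟩
    · rw [hft] at this
      simp only [sub_zero] at this
      rw [div_mul_cancel₀ _ hpos.ne'] at this
      exact lt_irrefl _ this
    · have hv : v < 0 := by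
        have := hfv (0, 0) ⟨rfl, le_refl (0:ℝ)⟩
        have h0 : f ((0 : Fin n → ℝ), (0:ℝ)) = 0 := map_zero f
        linarith
      show v / s - 0 ≤ 0
      rw [sub_zero]
      exact div_nonpos_of_nonpos_of_nonneg hv.le hpos.le
  let z : Fin n → ℝ := fun i => f (Pi.single i 1, 0)
  have hfx : ∀ x : Fin n → ℝ, f (x, 0) = ∑ i, x i * z i := by
    intro x
    have h1 : (x, (0:ℝ)) = ∑ i, x i • ((Pi.single i 1 : Fin n → ℝ), (0:ℝ)) := by
      ext j
      · simp [Prod.fst_sum, Finset.sum_apply, Pi.single_apply]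
      · simp [Prod.snd_sum]
    rw [h1, map_sum]
    simp only [map_smul]
    rfl
  have hmain : ∀ α ∈ S, (∑ i, (α i - β i) * z i) + b α * s < u := by
    intro α hα
    have h := hfu (L (Pi.single ⟨α, hα⟩ 1)) ⟨_, single_mem_stdSimplex ℝ _, rfl⟩
    have h2 : L (Pi.single ⟨α, hα⟩ 1) = (α - β, b α) := by
      simp [L, Pi.single_apply]
    rw [h2] at h
    have h3 : (α - β, b α) = (α - β, (0:ℝ)) + ((0 : Fin n → ℝ), b α) := by simp
    rw [h3, map_add, hfx, hft] at h
    simpa using h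
  -- perturb s to be negative
  obtain ⟨d, hd, hdS⟩ : ∃ d : ℝ, 0 < d ∧ ∀ α ∈ S, (∑ i, (α i - β i) * z i) + b α * (s - d) < 0 := by
    have hM : 0 ≤ ∑ α ∈ S, |b α| := Finset.sum_nonneg fun _ _ => abs_nonneg _
    have hD : 0 < 1 + ∑ α ∈ S, |b α| := by linarith
    refine ⟨(-u) / (1 + ∑ α ∈ S, |b α|), div_pos (by linarith) hD, ?_⟩
    intro α hα
    have h1 := hmain α hα
    have h2 : |b α| ≤ ∑ α ∈ S, |b α| :=
      Finset.single_le_sum (f := fun α => |b α|) (fun _ _ => abs_nonneg _) hα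
    have h3 : (-u) / (1 + ∑ α ∈ S, |b α|) * (1 + ∑ α ∈ S, |b α|) = -u := div_mul_cancel₀ _ hD.ne'
    have h4 : 0 < (-u) / (1 + ∑ α ∈ S, |b α|) := div_pos (by linarith) hD
    have h5 := neg_abs_le (b α)
    nlinarith
  refine ⟨fun i => z i / (d - s), fun α hα => ?_⟩
  have h := hdS α hα
  have hp : 0 < d - s := by linarith
  have : ∑ i, (α i - β i) * (z i / (d - s)) = (∑ i, (α i - β i) * z i) / (d - s) := by
    rw [Finset.sum_div]
    exact Finset.sum_congr rfl fun i _ => by ring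
  rw [this, div_lt_iff₀ hp]
  linarith

theorem age_sage {n : ℕ} {T : Finset (Fin n → ℝ)} {β : Fin n → ℝ} (hβ : β ∈ T)
    {c : (Fin n → ℝ) → ℝ} (hc : InAGE n T β c) : InSAGE n T c := by
  refine ⟨fun γ α => if γ = β then c α else 0, ?_, ?_⟩
  · intro γ _
    by_cases h : γ = β
    · subst h; simpa using hc
    · simp [h, InAGE]
  · intro α _
    simp [hβ]

theorem dual_forward {n : ℕ} {T : Finset (Fin n → ℝ)} {v : (Fin n → ℝ) → ℝ}
    (hv : ∀ c : (Fin n → ℝ) → ℝ, InSAGE n T c → 0 ≤ ∑ α ∈ T, v α * c α)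
    (hv0 : ∀ α ∈ T, 0 ≤ v α)
    (A : Finset (Fin n → ℝ)) (β : Fin n → ℝ) (lam : (Fin n → ℝ) → ℝ) (hA : A ⊆ T)
    (hβ : β ∈ T) (hβA : β ∉ A) (hl : ∀ α ∈ A, 0 < lam α) (h1 : (∑ α ∈ A, lam α) = 1)
    (h2 : (∑ α ∈ A, lam α • α) = β) : v β ≤ ∏ α ∈ A, (v α) ^ (lam α) := by
  -- pairing against a vector supported on the circuit
  have hsum : ∀ (p q : (Fin n → ℝ) → ℝ) (r : ℝ),
      ∑ α ∈ T, q α * (if α ∈ A then p α else if α = β then r else 0)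
        = (∑ α ∈ A, q α * p α) + q β * r := by
    intro p q r
    have hsub : insert β A ⊆ T := Finset.insert_subset hβ hA
    rw [← Finset.sum_subset hsub, Finset.sum_insert hβA, add_comm]
    · congr 1
      · exact Finset.sum_congr rfl fun α hα => by simp [hα]
      · simp [hβA]
    · intro α _ hα
      rw [Finset.mem_insert, not_or] at hα
      simp [hα.1, hα.2]
  have hexp : ∀ y : Fin n → ℝ, ∑ α ∈ A, lam α * (∑ i, α i * y i) = ∑ i, β i * y i := by
    intro y
    rw [← h2]
    simp only [Finset.mul_sum, Finset.sum_apply, Pi.smul_apply, smul_eq_mul, Finset.sum_mul]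
    rw [Finset.sum_comm]
    simp only [mul_assoc]
  have heps : ∀ e : ℝ, 0 < e → v β ≤ ∏ α ∈ A, (v α + e) ^ (lam α) := by
    intro e he
    have hpos : ∀ α ∈ A, 0 < v α + e := fun α hα => by have := hv0 α (hA hα); linarith
    set P := ∏ α ∈ A, ((v α + e)⁻¹) ^ (lam α) with hP
    have hage : InAGE n T β (fun α => if α ∈ A then lam α * (v α + e)⁻¹ else
        if α = β then -P else 0) := by
      refine ⟨?_, ?_⟩
      · intro α _ hne
        by_cases hαA : α ∈ A
        · simp only [hαA, if_true]
          exact mul_nonneg (hl α hαA).le (inv_nonneg.2 (hpos α hαA).le)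
        · simp [hαA, hne]
      · intro y
        have := hsum (fun α => lam α * (v α + e)⁻¹) (fun α => Real.exp (∑ i, α i * y i)) (-P)
        simp only [mul_comm (Real.exp _)] at this
        rw [this]
        have amgm := Real.geom_mean_le_arith_mean_weighted A lam
          (fun α => (v α + e)⁻¹ * Real.exp (∑ i, α i * y i)) (fun α hα => (hl α hα).le) h1
          (fun α hα => mul_nonneg (inv_nonneg.2 (hpos α hα).le) (Real.exp_pos _).le)
        have hprod : ∏ α ∈ A, ((v α + e)⁻¹ * Real.exp (∑ i, α i * y i)) ^ lam α
            = P * Real.exp (∑ i, β i * y i) := by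
          rw [← hexp y, Real.exp_sum, hP, ← Finset.prod_mul_distrib]
          refine Finset.prod_congr rfl fun α hα => ?_
          rw [Real.mul_rpow (inv_nonneg.2 (hpos α hα).le) (Real.exp_pos _).le, ← Real.exp_mul,
            mul_comm (lam α)]
        rw [hprod] at amgm
        simp only [← mul_assoc] at amgm
        linarith
    have h := hv _ (age_sage hβ hage)
    rw [hsum (fun α => lam α * (v α + e)⁻¹) v (-P)] at h
    have hle : ∑ α ∈ A, v α * (lam α * (v α + e)⁻¹) ≤ 1 := by
      rw [← h1]
      refine Finset.sum_le_sum fun α hα => ?_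
      have hq : v α * (v α + e)⁻¹ ≤ 1 := by
        rw [← div_eq_mul_inv, div_le_one (hpos α hα)]
        linarith
      have := mul_le_mul_of_nonneg_left hq (hl α hα).le
      linarith
    have hPQ : P * ∏ α ∈ A, (v α + e) ^ (lam α) = 1 := by
      rw [hP, ← Finset.prod_mul_distrib]
      refine Finset.prod_eq_one fun α hα => ?_
      rw [← Real.mul_rpow (inv_nonneg.2 (hpos α hα).le) (hpos α hα).le,
        inv_mul_cancel₀ (hpos α hα).ne', Real.one_rpow]
    have hQ : 0 ≤ ∏ α ∈ A, (v α + e) ^ (lam α) :=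
      Finset.prod_nonneg fun α hα => Real.rpow_nonneg (hpos α hα).le _
    have hvP : v β * P ≤ 1 := by linarith
    calc v β = v β * P * ∏ α ∈ A, (v α + e) ^ (lam α) := by rw [mul_assoc, hPQ, mul_one]
      _ ≤ 1 * ∏ α ∈ A, (v α + e) ^ (lam α) := mul_le_mul_of_nonneg_right hvP hQ
      _ = _ := one_mul _
  have hcont : Continuous fun e : ℝ => ∏ α ∈ A, (v α + e) ^ (lam α) :=
    continuous_finsetProd _ fun α hα =>
      (continuous_const.add continuous_id).rpow_const fun _ => Or.inr (hl α hα).le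
  have ht := (hcont.tendsto 0).mono_left (nhdsWithin_le_nhds (s := Set.Ioi 0))
  simp only [add_zero] at ht
  refine ge_of_tendsto ht ?_
  filter_upwards [self_mem_nhdsWithin] with e he using heps e he

theorem dual_backward {n : ℕ} {T : Finset (Fin n → ℝ)} {v : (Fin n → ℝ) → ℝ}
    (hv0 : ∀ α ∈ T, 0 ≤ v α)
    (hcirc : ∀ (A : Finset (Fin n → ℝ)) (β : Fin n → ℝ) (lam : (Fin n → ℝ) → ℝ),
          A ⊆ T → AffineIndependent ℝ (fun x : A => (x : Fin n → ℝ)) →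
          β ∈ T → β ∉ A →
          (∀ α ∈ A, 0 < lam α) → (∑ α ∈ A, lam α) = 1 →
          (∑ α ∈ A, lam α • α) = β →
          v β ≤ ∏ α ∈ A, (v α) ^ (lam α))
    {β : Fin n → ℝ} (hβ : β ∈ T) {c : (Fin n → ℝ) → ℝ} (hc : InAGE n T β c) :
    0 ≤ ∑ α ∈ T, v α * c α := by
  obtain ⟨hc0, hc1⟩ := hc
  have hE0 : ∀ α ∈ T.erase β, 0 ≤ c α := fun α hα =>
    hc0 α (Finset.mem_of_mem_erase hα) (Finset.ne_of_mem_erase hα)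
  have hEv : ∀ α ∈ T.erase β, 0 ≤ v α := fun α hα => hv0 α (Finset.mem_of_mem_erase hα)
  rw [← Finset.add_sum_erase T _ hβ]
  rcases (hv0 β hβ).eq_or_lt with hvβ | hvβ
  · rw [← hvβ, zero_mul, zero_add]
    exact Finset.sum_nonneg fun α hα => mul_nonneg (hEv α hα) (hE0 α hα)
  have heps : ∀ e : ℝ, 0 < e → 0 ≤ v β * c β + ∑ α ∈ T.erase β, (v α + e) * c α := by
    intro e he
    have hpos : ∀ α ∈ T.erase β, 0 < v α + e := fun α hα => by have := hEv α hα; linarith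
    obtain ⟨y, hy⟩ := farkas_aux (fun α => Real.log (v α + e) - Real.log (v β)) β (T.erase β) (by
      intro lam g0 g1 g2
      by_contra! g3
      obtain ⟨A, mu, hA, hind, m0, m1, m2, m3⟩ :=
        carath_aux _ β _ (T.erase β) lam rfl g0 g1 g2 g3
      have hle := hcirc A β mu (hA.trans (Finset.erase_subset _ _)) hind hβ
        (fun h => (Finset.ne_of_mem_erase (hA h)) rfl) m0 m1 m2
      have hAne : A.Nonempty := by
        rw [Finset.nonempty_iff_ne_empty]
        rintro rfl
        simp at m1
      have hvp : ∀ α ∈ A, 0 < v α := by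
        intro α hα
        refine lt_of_le_of_ne (hEv α (hA hα)) fun h => ?_
        have : ∏ α ∈ A, (v α) ^ (mu α) = 0 :=
          Finset.prod_eq_zero hα (by rw [← h, Real.zero_rpow (m0 α hα).ne'])
        linarith
      have hlt : ∏ α ∈ A, (v α) ^ (mu α) < ∏ α ∈ A, (v α + e) ^ (mu α) :=
        Finset.prod_lt_prod_of_nonempty (fun α hα => Real.rpow_pos_of_pos (hvp α hα) _)
          (fun α hα => Real.rpow_lt_rpow (hvp α hα).le (by linarith) (m0 α hα)) hAne
      have hlog := Real.log_lt_log hvβ (hle.trans_lt hlt)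
      rw [Real.log_prod (fun α hα => (Real.rpow_pos_of_pos (hpos α (hA hα)) _).ne')] at hlog
      rw [Finset.sum_congr rfl (fun α hα => Real.log_rpow (hpos α (hA hα)) (mu α))] at hlog
      simp only [mul_sub, Finset.sum_sub_distrib, ← Finset.sum_mul, m1, one_mul] at m3
      linarith)
    have h := hc1 y
    rw [← Finset.add_sum_erase T _ hβ] at h
    set B := ∑ i, β i * y i with hB
    have hterm : ∀ α ∈ T.erase β, v β * Real.exp (-B) * (c α * Real.exp (∑ i, α i * y i))
        ≤ (v α + e) * c α := by
      intro α hα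
      have h1 := hy α hα
      simp only [sub_mul, Finset.sum_sub_distrib] at h1
      have h2 : v β * Real.exp (-B) * Real.exp (∑ i, α i * y i) ≤ v α + e := by
        rw [← Real.exp_log hvβ, ← Real.exp_add, ← Real.exp_add, ← Real.exp_log (hpos α hα)]
        apply Real.exp_le_exp.2
        linarith
      calc _ = v β * Real.exp (-B) * Real.exp (∑ i, α i * y i) * c α := by ring
        _ ≤ _ := mul_le_mul_of_nonneg_right h2 (hE0 α hα)
    have hs := Finset.sum_le_sum hterm
    rw [← Finset.mul_sum] at hs
    have hm := mul_nonneg (mul_nonneg hvβ.le (Real.exp_pos (-B)).le) h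
    have hb : Real.exp (-B) * Real.exp B = 1 := by rw [← Real.exp_add]; simp
    have hb2 : v β * Real.exp (-B) * (c β * Real.exp B) = v β * c β := by
      calc _ = v β * c β * (Real.exp (-B) * Real.exp B) := by ring
        _ = _ := by rw [hb, mul_one]
    rw [mul_add, hb2] at hm
    linarith
  have hcont : Continuous fun e : ℝ => v β * c β + ∑ α ∈ T.erase β, (v α + e) * c α := by
    fun_prop
  have ht := (hcont.tendsto 0).mono_left (nhdsWithin_le_nhds (s := Set.Ioi 0))
  simp only [add_zero] at ht
  refine ge_of_tendsto ht ?_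
  filter_upwards [self_mem_nhdsWithin] with e he using heps e he

/-- A vector `v` lies in the dual SAGE cone `C_SAGE(𝒜)*` iff `v ≥ 0` and for every
circuit `(A, β)` with `A ⊆ 𝒜`, `β ∈ 𝒜 \ A` and barycentric coordinates `λ` one has
`v_β ≤ ∏_{α ∈ A} v_α^{λ_α}`. -/
theorem stmt9 (n : ℕ) (𝒜 : Finset (Fin n → ℝ)) (h𝒜 : 𝒜.Nonempty)
    (v : (Fin n → ℝ) → ℝ) :
    (∀ c : (Fin n → ℝ) → ℝ, InSAGE n 𝒜 c → 0 ≤ ∑ α ∈ 𝒜, v α * c α) ↔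
      ((∀ α ∈ 𝒜, 0 ≤ v α) ∧
        ∀ (A : Finset (Fin n → ℝ)) (β : Fin n → ℝ) (lam : (Fin n → ℝ) → ℝ),
          A ⊆ 𝒜 → AffineIndependent ℝ (fun x : A => (x : Fin n → ℝ)) →
          β ∈ 𝒜 → β ∉ A →
          (∀ α ∈ A, 0 < lam α) → (∑ α ∈ A, lam α) = 1 →
          (∑ α ∈ A, lam α • α) = β →
          v β ≤ ∏ α ∈ A, (v α) ^ (lam α)) := by
  constructor
  · intro hv
    have hv0 : ∀ α ∈ 𝒜, 0 ≤ v α := by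
      intro α hα
      have h := hv (fun γ => if γ = α then 1 else 0) (age_sage hα ⟨?_, ?_⟩)
      · simpa [hα] using h
      · intro γ _ hne
        simp [hne]
      · intro y
        refine Finset.sum_nonneg fun γ _ => mul_nonneg ?_ (Real.exp_pos _).le
        dsimp only
        split_ifs <;> norm_num
    refine ⟨hv0, ?_⟩
    intro A β lam hA _ hβ hβA hl h1 h2
    exact dual_forward hv hv0 A β lam hA hβ hβA hl h1 h2
  · rintro ⟨hv0, hcirc⟩ c ⟨w, hw, hcw⟩
    have : ∑ α ∈ 𝒜, v α * c α = ∑ β ∈ 𝒜, ∑ α ∈ 𝒜, v α * w β α := by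
      rw [Finset.sum_comm]
      refine Finset.sum_congr rfl fun α hα => ?_
      rw [hcw α hα, Finset.mul_sum]
    rw [this]
    exact Finset.sum_nonneg fun β hβ => dual_backward hv0 hcirc hβ (hw β hβ)
end
end

section
/- Let (A, β) be a rational circuit in ℝⁿ with barycentric coordinates λ_α = p_α/p (p_α, p positive integers, Σ_{α∈A} p_α = p). Then the dual cone of the even circuit cone Pᵉ(A, β) is (Pᵉ(A, β))* = { v ∈ ℝ^{A∪{β}} : v_γ ≥ 0 for all γ ∈ A ∪ {β} and v_β^p ≤ ∏_{α∈A} v_α^{p_α} }. -/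
noncomputable section

/-- Membership in the cone `Pᵉ(A, β)` of nonnegative even AG functions
(identified with exponential sums). -/
def InPe (n : ℕ) (A : Finset (Fin n → ℝ)) (β : Fin n → ℝ) (c : (Fin n → ℝ) → ℝ) : Prop :=
  (∀ α ∈ A, 0 ≤ c α) ∧
    ∀ y : Fin n → ℝ,
      0 ≤ ∑ α ∈ A, c α * Real.exp (∑ i, α i * y i) + c β * Real.exp (∑ i, β i * y i)

lemma exists_fit {n : ℕ} (A : Finset (Fin n → ℝ))
    (hind : AffineIndependent ℝ (fun x : A => (x : Fin n → ℝ))) (f : (Fin n → ℝ) → ℝ) :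
    ∃ (y : Fin n → ℝ) (s : ℝ), ∀ α ∈ A, f α = ∑ i, α i * y i + s := by
  have hli : LinearIndependent ℝ (fun x : A => (((x : Fin n → ℝ), (1 : ℝ)) : (Fin n → ℝ) × ℝ)) := by
    rw [linearIndependent_iff']
    intro S g hg i hi
    rw [affineIndependent_iff] at hind
    have h1 := congrArg Prod.fst hg
    have h2 := congrArg Prod.snd hg
    simp [Prod.fst_sum, Prod.snd_sum] at h1 h2
    exact hind S g h2 h1 i hi
  let b := Module.Basis.span hli
  obtain ⟨L, hL⟩ := LinearMap.exists_extend (b.constr ℝ (fun x : A => f x))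
  refine ⟨fun i => L (Pi.single i 1, 0), L (0, 1), fun α hα => ?_⟩
  have h1 : L (α, 1) = f α := by
    have h := b.constr_basis ℝ (fun x : A => f x) ⟨α, hα⟩
    rw [← hL] at h
    rw [← h]
    simp [b, Module.Basis.span_apply]
  have h2 : ((α, 1) : (Fin n → ℝ) × ℝ)
      = ∑ i, α i • ((Pi.single i 1, 0) : (Fin n → ℝ) × ℝ) + (0, 1) := by
    ext j
    · simp [Prod.fst_sum, Finset.sum_apply, Pi.single_apply]
    · simp [Prod.snd_sum]
  rw [← h1, h2, map_add, map_sum]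
  simp only [map_smul, smul_eq_mul]

/-- Weighted AM-GM in exponential form. -/
lemma amgm_exp {n : ℕ} (A : Finset (Fin n → ℝ)) (β : Fin n → ℝ)
    (l : (Fin n → ℝ) → ℝ) (hl : ∀ α ∈ A, 0 ≤ l α) (hsum : ∑ α ∈ A, l α = 1)
    (hbary : ∑ α ∈ A, l α • α = β) (z : Fin n → ℝ) (s : ℝ) :
    ∑ α ∈ A, l α * (∑ i, α i * z i + s) = ∑ i, β i * z i + s := by
  simp only [mul_add, Finset.sum_add_distrib, ← Finset.sum_mul, hsum, one_mul]
  congr 1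
  rw [← hbary]
  simp only [Finset.mul_sum, Finset.sum_apply, Pi.smul_apply, smul_eq_mul, Finset.sum_mul]
  rw [Finset.sum_comm]
  simp [mul_assoc]

lemma ge_pow {n : ℕ} {A : Finset (Fin n → ℝ)} {β : Fin n → ℝ}
    {p : ℕ} {pA : (Fin n → ℝ) → ℕ} (hp : 0 < p)
    (hpsum : ∑ α ∈ A, pA α = p)
    (hbary : ∑ α ∈ A, ((pA α : ℝ) / p) • α = β)
    {w : (Fin n → ℝ) → ℝ} (y : Fin n → ℝ) (s : ℝ)
    (hw : ∀ α ∈ A, w α = Real.exp (∑ i, α i * y i + s)) :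
    ∏ α ∈ A, w α ^ pA α = Real.exp (∑ i, β i * y i + s) ^ p := by
  have hp' : (p : ℝ) ≠ 0 := by positivity
  have hs : ∑ α ∈ A, (pA α : ℝ) / p = 1 := by
    rw [← Finset.sum_div, ← Nat.cast_sum, hpsum, div_self hp']
  rw [← amgm_exp A β _ (fun _ _ => by positivity) hs hbary y s, ← Real.exp_nat_mul,
    Finset.mul_sum, Real.exp_sum]
  refine Finset.prod_congr rfl fun α hα => ?_
  rw [hw α hα, ← Real.exp_nat_mul]
  congr 1
  field_simp

lemma pos_case {n : ℕ} {A : Finset (Fin n → ℝ)} {β : Fin n → ℝ}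
    (hind : AffineIndependent ℝ (fun x : A => (x : Fin n → ℝ))) (hβA : β ∉ A)
    {p : ℕ} {pA : (Fin n → ℝ) → ℕ} (hp : 0 < p)
    (hpsum : ∑ α ∈ A, pA α = p)
    (hbary : ∑ α ∈ A, ((pA α : ℝ) / p) • α = β)
    (w : (Fin n → ℝ) → ℝ) (b : ℝ) (hw : ∀ α ∈ A, 0 < w α) (hb : 0 ≤ b)
    (h : ∀ c : (Fin n → ℝ) → ℝ, InPe n A β c → 0 ≤ ∑ α ∈ A, w α * c α + b * c β) :
    b ^ p ≤ ∏ α ∈ A, w α ^ pA α := by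
  obtain ⟨y, s, hys⟩ := exists_fit A hind (fun α => Real.log (w α))
  have hw' : ∀ α ∈ A, w α = Real.exp (∑ i, α i * y i + s) := fun α hα => by
    rw [← hys α hα, Real.exp_log (hw α hα)]
  rw [ge_pow hp hpsum hbary y s hw']
  refine pow_le_pow_left₀ hb ?_ p
  have hp' : (p : ℝ) ≠ 0 := by positivity
  have hs : ∑ α ∈ A, (pA α : ℝ) / p = 1 := by
    rw [← Finset.sum_div, ← Nat.cast_sum, hpsum, div_self hp']
  classical
  have hne : ∀ α ∈ A, α ≠ β := fun α hα e => hβA (e ▸ hα)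
  have key := h (fun x => if x = β then - Real.exp (-(∑ i, β i * y i + s))
    else (pA x : ℝ) / p * Real.exp (-(∑ i, x i * y i + s))) ⟨?_, ?_⟩
  · rw [Finset.sum_congr rfl (g := fun α => (pA α : ℝ) / p), hs] at key
    · simp only [if_true] at key
      rw [Real.exp_neg] at key
      have he := Real.exp_pos (∑ i, β i * y i + s)
      have : b * (Real.exp (∑ i, β i * y i + s))⁻¹ ≤ 1 := by linarith
      rwa [← div_eq_mul_inv, div_le_one he] at this
    · intro α hα
      simp only [if_neg (hne α hα)]
      rw [hw' α hα, Real.exp_neg]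
      have he := Real.exp_pos (∑ i, α i * y i + s)
      field_simp
  · intro α hα
    simp only [if_neg (hne α hα)]
    positivity
  · intro z
    have hj := convexOn_exp.map_sum_le (t := A) (w := fun α => (pA α : ℝ) / p)
      (p := fun α => ∑ i, α i * (z i - y i) + -s) (fun _ _ => by positivity) hs
      (fun _ _ => Set.mem_univ _)
    simp only [smul_eq_mul] at hj
    rw [amgm_exp A β _ (fun _ _ => by positivity) hs hbary (fun i => z i - y i) (-s)] at hj
    have e : ∀ x : Fin n → ℝ, Real.exp (∑ i, x i * (z i - y i) + -s)
        = Real.exp (-(∑ i, x i * y i + s)) * Real.exp (∑ i, x i * z i) := by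
      intro x
      rw [← Real.exp_add]
      congr 1
      simp only [mul_sub, Finset.sum_sub_distrib]
      ring
    rw [e] at hj
    rw [Finset.sum_congr rfl (g := fun α => (pA α : ℝ) / p *
      Real.exp (∑ i, α i * (z i - y i) + -s))]
    · simp only [if_true]
      linarith
    · intro α hα
      simp only [if_neg (hne α hα)]
      rw [e, mul_assoc]

/-- For a rational circuit `(A, β)` with barycentric coordinates `λ_α = p_α / p`, the dual
cone of `Pᵉ(A, β)` consists of the `v ≥ 0` with `v_β^p ≤ ∏_{α ∈ A} v_α^{p_α}`. -/
theorem stmt10 (n : ℕ) (A : Finset (Fin n → ℝ)) (β : Fin n → ℝ)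
    (hind : AffineIndependent ℝ (fun x : A => (x : Fin n → ℝ))) (hβA : β ∉ A)
    (p : ℕ) (pA : (Fin n → ℝ) → ℕ) (hp : 0 < p) (hpA : ∀ α ∈ A, 0 < pA α)
    (hpsum : ∑ α ∈ A, pA α = p)
    (hbary : ∑ α ∈ A, ((pA α : ℝ) / p) • α = β)
    (v : (Fin n → ℝ) → ℝ) :
    (∀ c : (Fin n → ℝ) → ℝ, InPe n A β c →
        0 ≤ ∑ α ∈ A, v α * c α + v β * c β) ↔
      ((∀ α ∈ A, 0 ≤ v α) ∧ 0 ≤ v β ∧ v β ^ p ≤ ∏ α ∈ A, v α ^ pA α) := by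
  classical
  have hne : ∀ α ∈ A, α ≠ β := fun α hα e => hβA (e ▸ hα)
  constructor
  · intro h
    have hA : ∀ α ∈ A, 0 ≤ v α := by
      intro α hα
      have := h (fun x => if x = α then 1 else 0) ⟨fun x _ => by positivity, fun y => by positivity⟩
      simpa [hα, (hne α hα).symm] using this
    have hB : 0 ≤ v β := by
      have := h (fun x => if x = β then 1 else 0) ⟨fun x _ => by positivity, fun y => by positivity⟩
      simpa [hβA] using this
    refine ⟨hA, hB, ?_⟩
    have hε : ∀ ε : ℝ, 0 < ε → v β ^ p ≤ ∏ α ∈ A, (v α + ε) ^ pA α := by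
      intro ε hε
      refine pos_case hind hβA hp hpsum hbary (fun α => v α + ε) (v β)
        (fun α hα => by have := hA α hα; positivity) hB ?_
      intro c hc
      refine (h c hc).trans ?_
      gcongr with α hα
      · exact hc.1 α hα
      · linarith
    have hcont : Continuous (fun ε : ℝ => ∏ α ∈ A, (v α + ε) ^ pA α) := by fun_prop
    have ht := (hcont.tendsto 0).mono_left (nhdsWithin_le_nhds (s := Set.Ioi 0))
    simp only [add_zero] at ht
    exact ge_of_tendsto ht (eventually_mem_nhdsWithin.mono fun ε h => hε ε h)
  · rintro ⟨hA, hB, hle⟩ c ⟨hc1, hc2⟩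
    have hsum : 0 ≤ ∑ α ∈ A, v α * c α :=
      Finset.sum_nonneg fun α hα => mul_nonneg (hA α hα) (hc1 α hα)
    rcases le_or_gt 0 (c β) with hcβ | hcβ
    · positivity
    by_cases hpos : ∀ α ∈ A, 0 < v α
    · obtain ⟨y, s, hys⟩ := exists_fit A hind (fun α => Real.log (v α))
      have hw' : ∀ α ∈ A, v α = Real.exp (∑ i, α i * y i + s) := fun α hα => by
        rw [← hys α hα, Real.exp_log (hpos α hα)]
      rw [ge_pow hp hpsum hbary y s hw'] at hle
      have hb := le_of_pow_le_pow_left₀ hp.ne' (Real.exp_pos _).le hle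
      have h2 := mul_nonneg (Real.exp_pos s).le (hc2 y)
      rw [mul_add, Finset.mul_sum] at h2
      rw [Finset.sum_congr rfl (g := fun α => v α * c α)] at h2
      · rw [Real.exp_add] at hb
        nlinarith
      · intro α hα
        rw [hw' α hα, Real.exp_add]
        ring
    · push Not at hpos
      obtain ⟨α, hα, h0⟩ := hpos
      have h0' : v α = 0 := le_antisymm h0 (hA α hα)
      rw [Finset.prod_eq_zero hα (by rw [h0', zero_pow (hpA α hα).ne'])] at hle
      have : v β = 0 := by
        have := le_antisymm hle (pow_nonneg hB p)
        exact pow_eq_zero_iff hp.ne' |>.1 this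
      rw [this]; linarith
end
end

section
/- Let (A, β) be a rational circuit in ℝⁿ with λ_α = p_α/p, m = ⌈log₂ p⌉, and let σ : {1,…,2^m} → A ∪ {β} be a leaf assignment. Let v ∈ ℝ^{A∪{β}} and suppose there exist real numbers y_{k,i} (1 ≤ k ≤ m−1, 1 ≤ i ≤ 2^{m−k}) such that, setting y_{0,j} := v_{σ(j)} for 1 ≤ j ≤ 2^m and y_{m,1} := v_β, all values y_{k,i} (0 ≤ k ≤ m) are nonnegative and y_{k,i}² ≤ y_{k−1,2i−1}·y_{k−1,2i} for all 1 ≤ k ≤ m, 1 ≤ i ≤ 2^{m−k}. Then v_α ≥ 0 for all α ∈ A, v_β ≥ 0, and v_β^p ≤ ∏_{α∈A} v_α^{p_α}. -/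
attribute [local instance] Classical.propDecidable

lemma prod_pairs_aux (f : ℕ → ℝ) (N : ℕ) :
    ∏ i ∈ Finset.Icc 1 (2 * N), f i = ∏ i ∈ Finset.Icc 1 N, (f (2 * i - 1) * f (2 * i)) := by
  induction N with
  | zero => simp
  | succ N ih =>
    rw [show 2 * (N + 1) = (2 * N + 1) + 1 by ring, Finset.prod_Icc_succ_top (by omega),
      Finset.prod_Icc_succ_top (by omega), Finset.prod_Icc_succ_top (by omega), ih,
      show 2 * (N + 1) - 1 = 2 * N + 1 by omega, show 2 * (N + 1) = 2 * N + 1 + 1 by ring]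
    ring

/-- If `v` admits a nonnegative binary tree of auxiliary values `y` (with leaves given by a
leaf assignment `σ` of the rational circuit `(A, β)` and root `v_β`) satisfying the
geometric-mean inequalities, then `v ≥ 0` on `A ∪ {β}` and `v_β^p ≤ ∏_{α ∈ A} v_α^{p_α}`. -/
theorem stmt12 (n : ℕ) (A : Finset (Fin n → ℝ)) (β : Fin n → ℝ)
    (hind : AffineIndependent ℝ (fun x : A => (x : Fin n → ℝ))) (hβA : β ∉ A)
    (p : ℕ) (pA : (Fin n → ℝ) → ℕ) (hp : 0 < p) (hpA : ∀ α ∈ A, 0 < pA α)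
    (hpsum : ∑ α ∈ A, pA α = p)
    (hbary : ∑ α ∈ A, ((pA α : ℝ) / p) • α = β)
    (m : ℕ) (hm : m = Nat.clog 2 p)
    (σ : ℕ → (Fin n → ℝ))
    (hσmem : ∀ j ∈ Finset.Icc 1 (2 ^ m), σ j ∈ A ∨ σ j = β)
    (hσA : ∀ α ∈ A, ((Finset.Icc 1 (2 ^ m)).filter fun j => σ j = α).card = pA α)
    (hσβ : ((Finset.Icc 1 (2 ^ m)).filter fun j => σ j = β).card = 2 ^ m - p)
    (v : (Fin n → ℝ) → ℝ) (y : ℕ → ℕ → ℝ)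
    (hy0 : ∀ j ∈ Finset.Icc 1 (2 ^ m), y 0 j = v (σ j))
    (hym : y m 1 = v β)
    (hnn : ∀ k, k ≤ m → ∀ i ∈ Finset.Icc 1 (2 ^ (m - k)), 0 ≤ y k i)
    (hsq : ∀ k, 1 ≤ k → k ≤ m → ∀ i ∈ Finset.Icc 1 (2 ^ (m - k)),
      (y k i) ^ 2 ≤ y (k - 1) (2 * i - 1) * y (k - 1) (2 * i)) :
    (∀ α ∈ A, 0 ≤ v α) ∧ 0 ≤ v β ∧ v β ^ p ≤ ∏ α ∈ A, v α ^ pA α := by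
  have hv : ∀ j ∈ Finset.Icc 1 (2 ^ m), 0 ≤ v (σ j) := fun j hj => by
    rw [← hy0 j hj]; exact hnn 0 (Nat.zero_le _) j (by simpa using hj)
  have h1 : ∀ α ∈ A, 0 ≤ v α := by
    intro α hα
    have hc := hσA α hα
    have hpos := hpA α hα
    rw [← hc, Finset.card_pos] at hpos
    obtain ⟨j, hj⟩ := hpos
    rw [Finset.mem_filter] at hj
    have := hv j hj.1
    rwa [hj.2] at this
  have h2 : 0 ≤ v β := by
    rw [← hym]; exact hnn m le_rfl 1 (by simp)
  refine ⟨h1, h2, ?_⟩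
  have key : ∀ k, k ≤ m → (v β) ^ (2 ^ k) ≤ ∏ i ∈ Finset.Icc 1 (2 ^ k), y (m - k) i := by
    intro k
    induction k with
    | zero => intro _; simp [hym]
    | succ k ih =>
      intro hk
      have ih' := ih (by omega)
      rw [pow_succ 2 k, pow_mul, mul_comm (2 ^ k) 2, prod_pairs_aux]
      have e : m - (m - k) = k := by omega
      calc ((v β) ^ (2 ^ k)) ^ 2 ≤ (∏ i ∈ Finset.Icc 1 (2 ^ k), y (m - k) i) ^ 2 :=
            pow_le_pow_left₀ (pow_nonneg h2 _) ih' 2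
        _ = ∏ i ∈ Finset.Icc 1 (2 ^ k), (y (m - k) i) ^ 2 := by rw [Finset.prod_pow]
        _ ≤ _ := by
          apply Finset.prod_le_prod
          · intro i _; positivity
          · intro i hi
            have := hsq (m - k) (by omega) (by omega) i (by rwa [e])
            rwa [show m - k - 1 = m - (k + 1) by omega] at this
  have hk := key m le_rfl
  have hpm : p ≤ 2 ^ m := by rw [hm]; exact Nat.le_pow_clog (by norm_num) p
  have hprod : ∏ i ∈ Finset.Icc 1 (2 ^ m), y (m - m) i
      = (v β) ^ (2 ^ m - p) * ∏ α ∈ A, v α ^ pA α := by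
    rw [Nat.sub_self, Finset.prod_congr rfl hy0,
      ← Finset.prod_fiberwise_of_maps_to (t := insert β A) (g := σ)
        (fun j hj => by rw [Finset.mem_insert]; exact (hσmem j hj).symm),
      Finset.prod_insert hβA]
    have hf : ∀ b, ∏ j ∈ (Finset.Icc 1 (2 ^ m)).filter (fun j => σ j = b), v (σ j)
        = v b ^ ((Finset.Icc 1 (2 ^ m)).filter (fun j => σ j = b)).card := by
      intro b
      apply Finset.prod_eq_pow_card
      intro j hj
      rw [(Finset.mem_filter.1 hj).2]
    congr 1
    · rw [← hσβ]; convert hf β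
    · apply Finset.prod_congr rfl
      intro α hα
      rw [← hσA α hα]; convert hf α
  rw [hprod] at hk
  rcases h2.eq_or_lt with h0 | h0
  · rw [← h0, zero_pow hp.ne']
    exact Finset.prod_nonneg fun α hα => pow_nonneg (h1 α hα) _
  · rw [← Nat.sub_add_cancel hpm, pow_add, Nat.sub_add_cancel hpm] at hk
    exact le_of_mul_le_mul_left hk (pow_pos h0 _)
end

section
/- Let (A, β) be a rational circuit in ℝⁿ with λ_α = p_α/p, m = ⌈log₂ p⌉, and let σ : {1,…,2^m} → A ∪ {β} be a leaf assignment. Let v ∈ ℝ^{A∪{β}} satisfy v_γ ≥ 0 for all γ ∈ A ∪ {β} and v_β^p ≤ ∏_{α∈A} v_α^{p_α}. Then there exist nonnegative real numbers y_{k,i} (1 ≤ k ≤ m−1, 1 ≤ i ≤ 2^{m−k}) such that, setting y_{0,j} := v_{σ(j)} and y_{m,1} := v_β, the inequalities y_{k,i}² ≤ y_{k−1,2i−1}·y_{k−1,2i} hold for all 1 ≤ k ≤ m, 1 ≤ i ≤ 2^{m−k}. -/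
attribute [local instance] Classical.propDecidable

/-- The tree of iterated geometric means. -/
noncomputable def gmTree (w : ℕ → ℝ) : ℕ → ℕ → ℝ
  | 0, j => w j
  | k + 1, i => Real.sqrt (gmTree w k (2 * i - 1) * gmTree w k (2 * i))

theorem gmTree_nonneg (w : ℕ → ℝ) (hw : ∀ j, 0 ≤ w j) (k i : ℕ) : 0 ≤ gmTree w k i := by
  cases k with
  | zero => exact hw i
  | succ k => exact Real.sqrt_nonneg _

theorem gmTree_sq (w : ℕ → ℝ) (hw : ∀ j, 0 ≤ w j) (k i : ℕ) :
    gmTree w (k + 1) i ^ 2 = gmTree w k (2 * i - 1) * gmTree w k (2 * i) :=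
  Real.sq_sqrt (mul_nonneg (gmTree_nonneg w hw _ _) (gmTree_nonneg w hw _ _))

theorem gmTree_pow (w : ℕ → ℝ) (hw : ∀ j, 0 ≤ w j) (k : ℕ) : ∀ i : ℕ,
    gmTree w k (i + 1) ^ (2 ^ k) =
      ∏ j ∈ Finset.Ico (i * 2 ^ k) ((i + 1) * 2 ^ k), w (j + 1) := by
  induction k with
  | zero => intro i; simp [gmTree]
  | succ k ih =>
    intro i
    have e1 : 2 * (i + 1) - 1 = 2 * i + 1 := by omega
    have e2 : 2 * (i + 1) = (2 * i + 1) + 1 := by omega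
    rw [pow_succ' 2 k, pow_mul, gmTree_sq w hw, e1, e2, mul_pow, ih, ih,
      Finset.prod_Ico_consecutive]
    · congr 2 <;> ring
    · gcongr; omega
    · gcongr; omega

/-- Conversely, if `v ≥ 0` on `A ∪ {β}` and `v_β^p ≤ ∏_{α ∈ A} v_α^{p_α}` for a rational
circuit `(A, β)` with leaf assignment `σ`, then there is a nonnegative binary tree of
auxiliary values `y` (with leaves `v_{σ(j)}` and root `v_β`) satisfying the
geometric-mean inequalities. -/
theorem stmt13 (n : ℕ) (A : Finset (Fin n → ℝ)) (β : Fin n → ℝ)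
    (hind : AffineIndependent ℝ (fun x : A => (x : Fin n → ℝ))) (hβA : β ∉ A)
    (p : ℕ) (pA : (Fin n → ℝ) → ℕ) (hp : 0 < p) (hpA : ∀ α ∈ A, 0 < pA α)
    (hpsum : ∑ α ∈ A, pA α = p)
    (hbary : ∑ α ∈ A, ((pA α : ℝ) / p) • α = β)
    (m : ℕ) (hm : m = Nat.clog 2 p)
    (σ : ℕ → (Fin n → ℝ))
    (hσmem : ∀ j ∈ Finset.Icc 1 (2 ^ m), σ j ∈ A ∨ σ j = β)
    (hσA : ∀ α ∈ A, ((Finset.Icc 1 (2 ^ m)).filter fun j => σ j = α).card = pA α)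
    (hσβ : ((Finset.Icc 1 (2 ^ m)).filter fun j => σ j = β).card = 2 ^ m - p)
    (v : (Fin n → ℝ) → ℝ)
    (hvA : ∀ α ∈ A, 0 ≤ v α) (hvβ : 0 ≤ v β)
    (hprod : v β ^ p ≤ ∏ α ∈ A, v α ^ pA α) :
    ∃ y : ℕ → ℕ → ℝ,
      (∀ j ∈ Finset.Icc 1 (2 ^ m), y 0 j = v (σ j)) ∧
      y m 1 = v β ∧
      (∀ k, k ≤ m → ∀ i ∈ Finset.Icc 1 (2 ^ (m - k)), 0 ≤ y k i) ∧
      (∀ k, 1 ≤ k → k ≤ m → ∀ i ∈ Finset.Icc 1 (2 ^ (m - k)),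
        (y k i) ^ 2 ≤ y (k - 1) (2 * i - 1) * y (k - 1) (2 * i)) := by
  have hm1 : 1 ≤ m := by
    by_contra hcon
    have hm0 : m = 0 := by omega
    have hp1 : p = 1 := by
      have := Nat.le_pow_clog (b := 2) (by norm_num) p
      rw [← hm, hm0] at this
      simp at this
      omega
    have hcard : A.card ≤ 1 := by
      rw [← hp1, ← hpsum, Finset.card_eq_sum_ones]
      exact Finset.sum_le_sum fun α hα => hpA α hα
    have hne : A.Nonempty := by
      rw [Finset.nonempty_iff_ne_empty]
      rintro rfl
      simp at hpsum
      omega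
    obtain ⟨a, rfl⟩ := Finset.card_eq_one.mp (le_antisymm hcard hne.card_pos)
    simp only [Finset.sum_singleton] at hpsum hbary
    rw [hpsum, hp1] at hbary
    apply hβA
    simp [← hbary]
  have hple : p ≤ 2 ^ m := by
    rw [hm]; exact Nat.le_pow_clog (by norm_num) p
  let w : ℕ → ℝ := fun j => |v (σ j)|
  have hw : ∀ j, 0 ≤ w j := fun j => abs_nonneg _
  have hwv : ∀ j ∈ Finset.Icc 1 (2 ^ m), w j = v (σ j) := by
    intro j hj
    apply abs_of_nonneg
    rcases hσmem j hj with h | h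
    · exact hvA _ h
    · rw [h]; exact hvβ
  have hfull : ∏ j ∈ Finset.Icc 1 (2 ^ m), w j
      = v β ^ (2 ^ m - p) * ∏ α ∈ A, v α ^ pA α := by
    rw [Finset.prod_congr rfl hwv,
      ← Finset.prod_fiberwise_of_maps_to (t := insert β A) (g := σ)
        (fun j hj => by
          rcases hσmem j hj with h | h
          · exact Finset.mem_insert_of_mem h
          · rw [h]; exact Finset.mem_insert_self _ _)]
    have hfib : ∀ γ ∈ insert β A,
        ∏ j ∈ (Finset.Icc 1 (2 ^ m)).filter (fun j => σ j = γ), v (σ j)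
          = v γ ^ ((Finset.Icc 1 (2 ^ m)).filter fun j => σ j = γ).card := by
      intro γ _
      apply Finset.prod_eq_pow_card
      intro j hj
      rw [(Finset.mem_filter.mp hj).2]
    rw [Finset.prod_congr rfl hfib, Finset.prod_insert hβA, hσβ]
    congr 1
    exact Finset.prod_congr rfl fun α hα => by rw [hσA α hα]
  have hroot : v β ≤ gmTree w m 1 := by
    have h := gmTree_pow w hw m 0
    have h2 : ∏ j ∈ Finset.Ico (0 * 2 ^ m) ((0 + 1) * 2 ^ m), w (j + 1)
        = ∏ j ∈ Finset.Icc 1 (2 ^ m), w j := by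
      rw [Finset.prod_Ico_add' w]
      congr 1
      ext j
      simp only [Finset.mem_Ico, Finset.mem_Icc]
      omega
    rw [h2, hfull, zero_add] at h
    refine le_of_pow_le_pow_left₀ (n := 2 ^ m) (by positivity) (gmTree_nonneg w hw _ _) ?_
    rw [h]
    calc v β ^ (2 ^ m) = v β ^ (2 ^ m - p) * v β ^ p := by
          rw [← pow_add]; congr 1; omega
      _ ≤ _ := mul_le_mul_of_nonneg_left hprod (pow_nonneg hvβ _)
  refine ⟨fun k i => if k = m then v β else gmTree w k i, ?_, by simp, ?_, ?_⟩
  · intro j hj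
    have : ¬ (0 = m) := by omega
    simp only [this, if_false]
    exact hwv j hj
  · intro k _ i _
    dsimp only
    split_ifs
    · exact hvβ
    · exact gmTree_nonneg w hw _ _
  · intro k hk hkm i hi
    obtain ⟨k, rfl⟩ : ∃ l, k = l + 1 := ⟨k - 1, by omega⟩
    have hne : ¬ (k = m) := by omega
    simp only [Nat.add_sub_cancel, hne, if_false]
    rw [← gmTree_sq w hw]
    split_ifs with hkm'
    · have hi1 : i = 1 := by
        rw [hkm'] at hi
        simpa using hi
      rw [hi1, hkm']
      exact pow_le_pow_left₀ hvβ hroot 2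
    · exact le_rfl
end

section
/- Let (A, β) be a rational circuit in ℝⁿ with λ_α = p_α/p, m = ⌈log₂ p⌉, and let σ : {1,…,2^m} → A ∪ {β} be a leaf assignment. A vector v ∈ ℝ^{A∪{β}} lies in the dual cone (Pᵉ(A, β))* if and only if there exist real numbers y_{k,i} (1 ≤ k ≤ m−1, 1 ≤ i ≤ 2^{m−k}) such that, setting y_{0,j} := v_{σ(j)} and y_{m,1} := v_β, all values y_{k,i} (0 ≤ k ≤ m) are nonnegative and y_{k,i}² ≤ y_{k−1,2i−1}·y_{k−1,2i} for all 1 ≤ k ≤ m, 1 ≤ i ≤ 2^{m−k}. -/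
attribute [local instance] Classical.propDecidable

noncomputable section

lemma aux_pair (N : ℕ) (g : ℕ → ℝ) :
    ∏ i ∈ Finset.Icc 1 (2 * N), g i = ∏ i ∈ Finset.Icc 1 N, (g (2 * i - 1) * g (2 * i)) := by
  induction N with
  | zero => simp
  | succ N ih =>
    rw [Finset.prod_Icc_succ_top (by omega), ← ih, show 2 * (N + 1) = 2 * N + 1 + 1 by ring,
      Finset.prod_Icc_succ_top (by omega), Finset.prod_Icc_succ_top (by omega)]
    simp [mul_assoc]

lemma aux_le (m : ℕ) (y : ℕ → ℕ → ℝ)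
    (h0 : ∀ k, k ≤ m → ∀ i ∈ Finset.Icc 1 (2 ^ (m - k)), 0 ≤ y k i)
    (h1 : ∀ k, 1 ≤ k → k ≤ m → ∀ i ∈ Finset.Icc 1 (2 ^ (m - k)),
          (y k i) ^ 2 ≤ y (k - 1) (2 * i - 1) * y (k - 1) (2 * i)) (k : ℕ) (hk : k ≤ m) :
    ∏ i ∈ Finset.Icc 1 (2 ^ (m - k)), (y k i) ^ (2 ^ k) ≤ ∏ j ∈ Finset.Icc 1 (2 ^ m), y 0 j := by
  induction k with
  | zero => simp
  | succ k ih =>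
    refine le_trans ?_ (ih (by omega))
    have e : 2 ^ (m - k) = 2 * 2 ^ (m - (k + 1)) := by
      rw [← pow_succ']; congr 1; omega
    rw [e, aux_pair]
    refine Finset.prod_le_prod (fun i hi => pow_nonneg (h0 _ hk i hi) _) (fun i hi => ?_)
    rw [pow_succ', pow_mul, ← mul_pow]
    exact pow_le_pow_left₀ (sq_nonneg _) (by simpa using h1 (k + 1) (by omega) hk i hi) _

lemma aux_eq (m : ℕ) (y : ℕ → ℕ → ℝ)
    (h1 : ∀ k i, (y (k + 1) i) ^ 2 = y k (2 * i - 1) * y k (2 * i)) (k : ℕ) (hk : k ≤ m) :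
    ∏ i ∈ Finset.Icc 1 (2 ^ (m - k)), (y k i) ^ (2 ^ k) = ∏ j ∈ Finset.Icc 1 (2 ^ m), y 0 j := by
  induction k with
  | zero => simp
  | succ k ih =>
    rw [← ih (by omega)]
    have e : 2 ^ (m - k) = 2 * 2 ^ (m - (k + 1)) := by
      rw [← pow_succ']; congr 1; omega
    rw [e, aux_pair]
    refine Finset.prod_congr rfl (fun i hi => ?_)
    rw [pow_succ', pow_mul, ← mul_pow, h1]

/-- The tree of iterated geometric means. -/
def auxTree (f : ℕ → ℝ) : ℕ → ℕ → ℝ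
  | 0, j => f j
  | k + 1, i => Real.sqrt (auxTree f k (2 * i - 1) * auxTree f k (2 * i))

lemma aux_affine (n : ℕ) (A : Finset (Fin n → ℝ))
    (hind : AffineIndependent ℝ (fun x : A => (x : Fin n → ℝ))) (w : (Fin n → ℝ) → ℝ)
    (hA : A.Nonempty) :
    ∃ (y : Fin n → ℝ) (s : ℝ), ∀ α ∈ A, ∑ i, α i * y i + s = w α := by
  obtain ⟨a, ha⟩ := hA
  have hl := (affineIndependent_iff_linearIndependent_vsub ℝ _ (⟨a, ha⟩ : A)).1 hind
  let b := Module.Basis.sumExtend hl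
  let L : (Fin n → ℝ) →ₗ[ℝ] ℝ :=
    b.constr ℝ (Sum.elim (fun x => w x.1 - w a) (fun _ => 0))
  refine ⟨fun i => L (Pi.single i 1), w a - L a, fun α hα => ?_⟩
  have hL : ∀ x : Fin n → ℝ, ∑ i, x i * L (Pi.single i 1) = L x := by
    intro x
    rw [LinearMap.pi_apply_eq_sum_univ L x]
    refine Finset.sum_congr rfl (fun i _ => ?_)
    rw [smul_eq_mul]
    congr 2
    ext j
    simp [Pi.single_apply, eq_comm]
  rw [hL]
  by_cases h : α = a
  · subst h; ring
  · have h2 : L (α - a) = w α - w a := by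
      have h3 : b (Sum.inl ⟨⟨α, hα⟩, by simpa using h⟩) = α - a := by
        simp [b, Module.Basis.sumExtend]
        rfl
      rw [← h3]
      simp [L]
    rw [map_sub] at h2
    linarith

lemma aux_leaves (n : ℕ) (A : Finset (Fin n → ℝ)) (β : Fin n → ℝ) (hβA : β ∉ A)
    (p : ℕ) (pA : (Fin n → ℝ) → ℕ)
    (m : ℕ) (σ : ℕ → (Fin n → ℝ))
    (hσmem : ∀ j ∈ Finset.Icc 1 (2 ^ m), σ j ∈ A ∨ σ j = β)
    (hσA : ∀ α ∈ A, ((Finset.Icc 1 (2 ^ m)).filter fun j => σ j = α).card = pA α)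
    (hσβ : ((Finset.Icc 1 (2 ^ m)).filter fun j => σ j = β).card = 2 ^ m - p)
    (v : (Fin n → ℝ) → ℝ) :
    ∏ j ∈ Finset.Icc 1 (2 ^ m), v (σ j) = v β ^ (2 ^ m - p) * ∏ α ∈ A, v α ^ pA α := by
  rw [← Finset.prod_fiberwise_of_maps_to (s := Finset.Icc 1 (2 ^ m)) (t := insert β A) (g := σ)
    (fun j hj => by rcases hσmem j hj with h | h <;> simp [h]), Finset.prod_insert hβA]
  have key : ∀ α, ∏ j ∈ (Finset.Icc 1 (2 ^ m)).filter (fun j => σ j = α), v (σ j)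
      = v α ^ ((Finset.Icc 1 (2 ^ m)).filter fun j => σ j = α).card := by
    intro α
    refine Finset.prod_eq_pow_card (fun j hj => ?_)
    rw [(Finset.mem_filter.1 hj).2]
  congr 1
  · rw [← hσβ, ← key]
  · refine Finset.prod_congr rfl (fun α hα => ?_)
    rw [← hσA α hα, ← key]

lemma aux_dual_s14 (n : ℕ) (A : Finset (Fin n → ℝ)) (β : Fin n → ℝ)
    (hind : AffineIndependent ℝ (fun x : A => (x : Fin n → ℝ))) (hβA : β ∉ A)
    (p : ℕ) (pA : (Fin n → ℝ) → ℕ) (hp : 0 < p) (hpA : ∀ α ∈ A, 0 < pA α)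
    (hpsum : ∑ α ∈ A, pA α = p)
    (hbary : ∑ α ∈ A, ((pA α : ℝ) / p) • α = β) (v : (Fin n → ℝ) → ℝ) :
    (∀ c : (Fin n → ℝ) → ℝ, InPe n A β c →
        0 ≤ ∑ α ∈ A, v α * c α + v β * c β) ↔
      (∀ α ∈ A, 0 ≤ v α) ∧ 0 ≤ v β ∧ v β ^ p ≤ ∏ α ∈ A, v α ^ pA α := by
  have hp' : (0 : ℝ) < p := by exact_mod_cast hp
  have hin : ∀ y : Fin n → ℝ,
      ∑ α ∈ A, ((pA α : ℝ) / p) * (∑ i, α i * y i) = ∑ i, β i * y i := by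
    intro y
    rw [← hbary]
    simp only [Finset.sum_apply, Pi.smul_apply, smul_eq_mul, Finset.sum_mul, Finset.mul_sum]
    rw [Finset.sum_comm]
    simp only [mul_assoc]
  have hsum1 : ∑ α ∈ A, ((pA α : ℝ) / p) = 1 := by
    rw [← Finset.sum_div, ← Nat.cast_sum, hpsum, div_self hp'.ne']
  constructor
  · intro h
    have hA0 : ∀ α ∈ A, 0 ≤ v α := by
      intro α hα
      have hne : β ≠ α := fun e => hβA (e ▸ hα)
      have := h (fun x => if x = α then 1 else 0) ⟨fun x _ => by dsimp only; split_ifs <;> simp,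
        fun y => by simp [hne, hα]; positivity⟩
      simpa [hne, hα] using this
    have hsz : ∀ g : (Fin n → ℝ) → ℝ, ∑ x ∈ A, g x * (if x = β then (1 : ℝ) else 0) = 0 := by
      intro g
      refine Finset.sum_eq_zero (fun x hx => ?_)
      rw [if_neg (show x ≠ β from fun e => hβA (e ▸ hx)), mul_zero]
    have hB0 : 0 ≤ v β := by
      have := h (fun x => if x = β then 1 else 0) ⟨fun x _ => by dsimp only; split_ifs <;> simp,
        fun y => by
          simp only [mul_comm _ (Real.exp _), hsz]; simp; positivity⟩
      simp only [hsz] at this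
      simpa using this
    refine ⟨hA0, hB0, ?_⟩
    have heps : ∀ ε : ℝ, 0 < ε → v β ^ p ≤ ∏ α ∈ A, (v α + ε) ^ pA α := by
      intro ε hε
      have hpos : ∀ α ∈ A, 0 < v α + ε := fun α hα => by have := hA0 α hα; linarith
      set T := ∑ α ∈ A, ((pA α : ℝ) / p) * Real.log (v α + ε) with hT
      have hc := h (fun x => if x = β then - Real.exp (-T) else ((pA x : ℝ) / p) * (v x + ε)⁻¹)
        ⟨fun x hx => by
          dsimp only
          rw [if_neg (show x ≠ β from fun e => hβA (e ▸ hx))]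
          have := hpos x hx
          positivity,
        fun y => by
          have e1 : ∑ α ∈ A, (if α = β then - Real.exp (-T) else ((pA α : ℝ) / p) * (v α + ε)⁻¹)
              * Real.exp (∑ i, α i * y i) = ∑ α ∈ A, ((pA α : ℝ) / p) •
                Real.exp (∑ i, α i * y i - Real.log (v α + ε)) := by
            refine Finset.sum_congr rfl (fun x hx => ?_)
            rw [if_neg (show x ≠ β from fun e => hβA (e ▸ hx)), Real.exp_sub, Real.exp_log (hpos x hx), smul_eq_mul]
            ring
          rw [e1]
          have := convexOn_exp.map_sum_le (t := A) (w := fun α => ((pA α : ℝ) / p))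
            (p := fun α => ∑ i, α i * y i - Real.log (v α + ε)) (fun _ _ => by positivity) hsum1
            (fun _ _ => Set.mem_univ _)
          have e2 : ∑ α ∈ A, ((pA α : ℝ) / p) • (∑ i, α i * y i - Real.log (v α + ε))
              = -T + ∑ i, β i * y i := by
            simp only [smul_eq_mul, mul_sub, Finset.sum_sub_distrib, hin, ← hT]
            ring
          rw [e2, Real.exp_add] at this
          simp only [if_true]
          linarith⟩
      have e3 : ∑ α ∈ A, v α * (if α = β then - Real.exp (-T) else ((pA α : ℝ) / p) * (v α + ε)⁻¹)
          ≤ 1 := by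
        rw [← hsum1]
        refine Finset.sum_le_sum (fun x hx => ?_)
        rw [if_neg (show x ≠ β from fun e => hβA (e ▸ hx))]
        have h1 := hpos x hx
        have h2 : v x * (v x + ε)⁻¹ ≤ 1 := by
          rw [← div_eq_mul_inv, div_le_one h1]; linarith
        have h3 : (0 : ℝ) ≤ (pA x : ℝ) / p := by positivity
        nlinarith
      simp only [if_true] at hc
      have h4 : v β ≤ Real.exp T := by
        have : v β * Real.exp (-T) ≤ 1 := by linarith
        rw [Real.exp_neg, ← div_eq_mul_inv, div_le_one (Real.exp_pos _)] at this
        exact this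
      calc v β ^ p ≤ Real.exp T ^ p := pow_le_pow_left₀ hB0 h4 _
        _ = ∏ α ∈ A, (v α + ε) ^ pA α := by
          rw [← Real.exp_nat_mul, hT, Finset.mul_sum, Real.exp_sum]
          refine Finset.prod_congr rfl (fun x hx => ?_)
          rw [← mul_assoc, mul_div_cancel₀ _ hp'.ne', Real.exp_nat_mul, Real.exp_log (hpos x hx)]
    have hlim : Filter.Tendsto (fun ε : ℝ => ∏ α ∈ A, (v α + ε) ^ pA α)
        (nhdsWithin 0 (Set.Ioi 0)) (nhds (∏ α ∈ A, v α ^ pA α)) := by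
      have hc : Continuous (fun ε : ℝ => ∏ α ∈ A, (v α + ε) ^ pA α) := by fun_prop
      have := (hc.tendsto 0).mono_left (nhdsWithin_le_nhds (s := Set.Ioi 0))
      simpa using this
    exact ge_of_tendsto hlim (by filter_upwards [self_mem_nhdsWithin] with ε hε using heps ε hε)
  · rintro ⟨hA0, hB0, hpr⟩ c ⟨hc0, hc⟩
    rcases hB0.eq_or_lt with hz | hB
    · rw [← hz, zero_mul, add_zero]
      exact Finset.sum_nonneg (fun x hx => mul_nonneg (hA0 x hx) (hc0 x hx))
    have hApos : ∀ α ∈ A, 0 < v α := by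
      intro α hα
      refine lt_of_le_of_ne (hA0 α hα) (fun e => ?_)
      have : ∏ α ∈ A, v α ^ pA α = 0 :=
        Finset.prod_eq_zero hα (by rw [← e, zero_pow (hpA α hα).ne'])
      have := pow_pos hB p
      linarith
    have hne : A.Nonempty := by
      rw [Finset.nonempty_iff_ne_empty]
      rintro rfl
      simp at hpsum; omega
    obtain ⟨y, s, hys⟩ := aux_affine n A hind (fun α => Real.log (v α)) hne
    have h1 := mul_nonneg (hc y) (Real.exp_pos s).le
    rw [add_mul, Finset.sum_mul, mul_assoc, ← Real.exp_add] at h1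
    have e1 : ∑ α ∈ A, c α * Real.exp (∑ i, α i * y i) * Real.exp s = ∑ α ∈ A, v α * c α := by
      refine Finset.sum_congr rfl (fun x hx => ?_)
      rw [mul_assoc, ← Real.exp_add, hys x hx, Real.exp_log (hApos x hx), mul_comm]
    rw [e1] at h1
    set E := ∑ i, β i * y i + s with hE
    have hEe : E = ∑ α ∈ A, ((pA α : ℝ) / p) * Real.log (v α) := by
      rw [hE, ← hin]
      calc _ = ∑ α ∈ A, ((pA α : ℝ) / p) * (∑ i, α i * y i) + (∑ α ∈ A, ((pA α : ℝ) / p)) * s := by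
            rw [hsum1, one_mul]
        _ = ∑ α ∈ A, ((pA α : ℝ) / p) * (∑ i, α i * y i + s) := by
            rw [Finset.sum_mul, ← Finset.sum_add_distrib]
            simp only [mul_add]
        _ = _ := Finset.sum_congr rfl (fun x hx => by rw [hys x hx])
    have hle : v β ≤ Real.exp E := by
      refine le_of_pow_le_pow_left₀ hp.ne' (Real.exp_pos _).le (hpr.trans (le_of_eq ?_))
      rw [← Real.exp_nat_mul, hEe, Finset.mul_sum, Real.exp_sum]
      refine Finset.prod_congr rfl (fun x hx => ?_)
      rw [← mul_assoc, mul_div_cancel₀ _ hp'.ne', Real.exp_nat_mul, Real.exp_log (hApos x hx)]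
    have hS : 0 ≤ ∑ α ∈ A, v α * c α :=
      Finset.sum_nonneg (fun x hx => mul_nonneg (hA0 x hx) (hc0 x hx))
    rcases le_or_gt 0 (c β) with hcb | hcb
    · have := mul_nonneg hB0 hcb
      linarith
    · nlinarith

/-- `v` lies in the dual cone `(Pᵉ(A, β))*` of a rational circuit `(A, β)` with leaf
assignment `σ` iff `v` admits a nonnegative binary tree of auxiliary values `y` (with
leaves `v_{σ(j)}` and root `v_β`) satisfying the geometric-mean inequalities. -/
theorem stmt14 (n : ℕ) (A : Finset (Fin n → ℝ)) (β : Fin n → ℝ)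
    (hind : AffineIndependent ℝ (fun x : A => (x : Fin n → ℝ))) (hβA : β ∉ A)
    (p : ℕ) (pA : (Fin n → ℝ) → ℕ) (hp : 0 < p) (hpA : ∀ α ∈ A, 0 < pA α)
    (hpsum : ∑ α ∈ A, pA α = p)
    (hbary : ∑ α ∈ A, ((pA α : ℝ) / p) • α = β)
    (m : ℕ) (hm : m = Nat.clog 2 p)
    (σ : ℕ → (Fin n → ℝ))
    (hσmem : ∀ j ∈ Finset.Icc 1 (2 ^ m), σ j ∈ A ∨ σ j = β)
    (hσA : ∀ α ∈ A, ((Finset.Icc 1 (2 ^ m)).filter fun j => σ j = α).card = pA α)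
    (hσβ : ((Finset.Icc 1 (2 ^ m)).filter fun j => σ j = β).card = 2 ^ m - p)
    (v : (Fin n → ℝ) → ℝ) :
    (∀ c : (Fin n → ℝ) → ℝ, InPe n A β c →
        0 ≤ ∑ α ∈ A, v α * c α + v β * c β) ↔
      ∃ y : ℕ → ℕ → ℝ,
        (∀ j ∈ Finset.Icc 1 (2 ^ m), y 0 j = v (σ j)) ∧
        y m 1 = v β ∧
        (∀ k, k ≤ m → ∀ i ∈ Finset.Icc 1 (2 ^ (m - k)), 0 ≤ y k i) ∧
        (∀ k, 1 ≤ k → k ≤ m → ∀ i ∈ Finset.Icc 1 (2 ^ (m - k)),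
          (y k i) ^ 2 ≤ y (k - 1) (2 * i - 1) * y (k - 1) (2 * i)) := by
  have hp2 : p ≠ 1 := by
    rintro rfl
    have hle : A.card ≤ 1 := by
      rw [← hpsum, Finset.card_eq_sum_ones]
      exact Finset.sum_le_sum (fun x hx => hpA x hx)
    have hne : A.Nonempty := by
      rw [Finset.nonempty_iff_ne_empty]
      rintro rfl
      simp at hpsum
    obtain ⟨a, rfl⟩ := Finset.card_eq_one.1 (le_antisymm hle hne.card_pos)
    simp at hpsum hbary
    apply hβA
    simp [← hbary, hpsum]
  have hpm : p ≤ 2 ^ m := hm ▸ Nat.le_pow_clog (by norm_num) p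
  have hm1 : m ≠ 0 := by
    rintro rfl
    simp at hpm; omega
  have hleaf := aux_leaves n A β hβA p pA m σ hσmem hσA hσβ v
  rw [aux_dual_s14 n A β hind hβA p pA hp hpA hpsum hbary v]
  constructor
  · rintro ⟨hA0, hB0, hpr⟩
    have hv0 : ∀ j ∈ Finset.Icc 1 (2 ^ m), 0 ≤ v (σ j) := by
      intro j hj
      rcases hσmem j hj with h | h
      · exact hA0 _ h
      · rw [h]; exact hB0
    set z := auxTree (fun j => |v (σ j)|) with hz
    have hz0 : ∀ k i, 0 ≤ z k i := by
      intro k i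
      cases k with
      | zero => simp [hz, auxTree]
      | succ k => simp [hz, auxTree]
    have hz1 : ∀ k i, (z (k + 1) i) ^ 2 = z k (2 * i - 1) * z k (2 * i) := by
      intro k i
      rw [show z (k + 1) i = Real.sqrt (z k (2 * i - 1) * z k (2 * i)) from rfl,
        Real.sq_sqrt (mul_nonneg (hz0 _ _) (hz0 _ _))]
    have hroot : v β ≤ z m 1 := by
      have h1 := aux_eq m z hz1 m le_rfl
      have h2 : ∏ j ∈ Finset.Icc 1 (2 ^ m), z 0 j = ∏ j ∈ Finset.Icc 1 (2 ^ m), v (σ j) :=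
        Finset.prod_congr rfl (fun j hj => abs_of_nonneg (hv0 j hj))
      rw [h2, hleaf] at h1
      simp at h1
      refine le_of_pow_le_pow_left₀ (n := 2 ^ m) (by positivity) (hz0 _ _) ?_
      rw [h1]
      calc v β ^ 2 ^ m = v β ^ (2 ^ m - p) * v β ^ p := by rw [← pow_add]; congr 1; omega
        _ ≤ _ := mul_le_mul_of_nonneg_left hpr (pow_nonneg hB0 _)
    refine ⟨fun k i => if k = m then v β else z k i, ?_, by simp, ?_, ?_⟩
    · intro j hj
      dsimp only
      rw [if_neg (Ne.symm hm1)]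
      exact abs_of_nonneg (hv0 j hj)
    · intro k _ i _
      dsimp only
      split_ifs
      · exact hB0
      · exact hz0 _ _
    · intro k hk1 hk i hi
      obtain ⟨k, rfl⟩ : ∃ l, k = l + 1 := ⟨k - 1, by omega⟩
      simp only [Nat.add_sub_cancel]
      rw [if_neg (show k ≠ m by omega), if_neg (show k ≠ m by omega), ← hz1]
      split_ifs with h
      · subst h
        have : i = 1 := by simpa using hi
        subst this
        exact pow_le_pow_left₀ hB0 hroot _
      · exact le_rfl
  · rintro ⟨y, hy0, hym, hyn, hyl⟩
    have hA0 : ∀ α ∈ A, 0 ≤ v α := by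
      intro α hα
      have h1 := hpA α hα
      rw [← hσA α hα, Finset.card_pos] at h1
      obtain ⟨j, hj⟩ := h1
      rw [Finset.mem_filter] at hj
      rw [← hj.2, ← hy0 j hj.1]
      exact hyn 0 (Nat.zero_le _) j (by simpa using hj.1)
    have hB0 : 0 ≤ v β := hym ▸ hyn m le_rfl 1 (by simp)
    refine ⟨hA0, hB0, ?_⟩
    rcases hB0.eq_or_lt with h | hB
    · rw [← h, zero_pow hp.ne']
      exact Finset.prod_nonneg (fun x hx => pow_nonneg (hA0 x hx) _)
    have h1 := aux_le m y hyn hyl m le_rfl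
    rw [Finset.prod_congr rfl hy0, hleaf] at h1
    simp only [Nat.sub_self, pow_zero, Finset.Icc_self, Finset.prod_singleton, hym] at h1
    refine le_of_mul_le_mul_left ?_ (pow_pos hB (2 ^ m - p))
    rw [← pow_add, Nat.sub_add_cancel hpm]
    exact h1
end
end

section
/- Let (A, β) be a rational circuit in ℝⁿ with λ_α = p_α/p, m = ⌈log₂ p⌉, leaf assignment σ, and set Λ = ∏_{α∈A} λ_α^{λ_α}. A vector c ∈ ℝ^{A∪{β}} lies in Pᵉ(A, β) if and only if there exist a real number x_β and real numbers x_{k,i} (1 ≤ k ≤ m, 1 ≤ i ≤ 2^{m−k}) such that, setting x_{0,j} := c_{σ(j)} if σ(j) ∈ A and x_{0,j} := Λ·x_β if σ(j) = β, one has: all values x_{k,i} (0 ≤ k ≤ m) are nonnegative; x_β + c_β ≥ 0; x_{m,1} ≥ Λ·x_β; and x_{k,i}² ≤ x_{k−1,2i−1}·x_{k−1,2i} for all 1 ≤ k ≤ m, 1 ≤ i ≤ 2^{m−k}. -/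
attribute [local instance] Classical.propDecidable

noncomputable section

lemma prod_Icc_pair (f : ℕ → ℝ) (N : ℕ) :
    ∏ j ∈ Finset.Icc 1 (2 * N), f j = ∏ i ∈ Finset.Icc 1 N, f (2 * i - 1) * f (2 * i) := by
  induction N with
  | zero => simp
  | succ N ih =>
    rw [Finset.prod_Icc_succ_top (by omega), ← ih, show 2 * (N + 1) = 2 * N + 1 + 1 by ring,
      Finset.prod_Icc_succ_top (by omega), Finset.prod_Icc_succ_top (by omega),
      show 2 * N + 1 + 1 - 1 = 2 * N + 1 by omega, mul_assoc]

lemma tree_le (m : ℕ) (x : ℕ → ℕ → ℝ)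
    (h : ∀ k, 1 ≤ k → k ≤ m → ∀ i ∈ Finset.Icc 1 (2 ^ (m - k)),
          (x k i) ^ 2 ≤ x (k - 1) (2 * i - 1) * x (k - 1) (2 * i)) (k : ℕ) (hk : k ≤ m) :
    ∏ i ∈ Finset.Icc 1 (2 ^ (m - k)), (x k i) ^ (2 ^ k) ≤ ∏ j ∈ Finset.Icc 1 (2 ^ m), x 0 j := by
  induction k with
  | zero => simp
  | succ k ih =>
    refine le_trans ?_ (ih (by omega))
    rw [show 2 ^ (m - k) = 2 * 2 ^ (m - (k + 1)) by rw [← pow_succ']; congr 1; omega,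
      prod_Icc_pair]
    apply Finset.prod_le_prod
    · intro i hi
      rw [pow_succ', pow_mul]; positivity
    · intro i hi
      rw [pow_succ', pow_mul, ← mul_pow]
      exact pow_le_pow_left₀ (sq_nonneg _) (h (k + 1) (by omega) hk i hi) _

def gtree (a : ℕ → ℝ) : ℕ → ℕ → ℝ
  | 0, j => a j
  | k + 1, i => Real.sqrt (gtree a k (2 * i - 1) * gtree a k (2 * i))

lemma gtree_nonneg (a : ℕ → ℝ) (ha : ∀ j, 0 ≤ a j) (k i : ℕ) : 0 ≤ gtree a k i := by
  cases k with
  | zero => exact ha i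
  | succ k => exact Real.sqrt_nonneg _

lemma gtree_sq (a : ℕ → ℝ) (ha : ∀ j, 0 ≤ a j) (k i : ℕ) :
    gtree a (k + 1) i ^ 2 = gtree a k (2 * i - 1) * gtree a k (2 * i) :=
  Real.sq_sqrt (mul_nonneg (gtree_nonneg a ha _ _) (gtree_nonneg a ha _ _))

lemma gtree_prod (m : ℕ) (a : ℕ → ℝ) (ha : ∀ j, 0 ≤ a j) (k : ℕ) (hk : k ≤ m) :
    ∏ i ∈ Finset.Icc 1 (2 ^ (m - k)), (gtree a k i) ^ (2 ^ k)
      = ∏ j ∈ Finset.Icc 1 (2 ^ m), a j := by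
  induction k with
  | zero => simp [gtree]
  | succ k ih =>
    rw [← ih (by omega)]
    rw [show 2 ^ (m - k) = 2 * 2 ^ (m - (k + 1)) by rw [← pow_succ']; congr 1; omega,
      prod_Icc_pair]
    apply Finset.prod_congr rfl
    intro i hi
    rw [pow_succ', pow_mul, ← mul_pow, gtree_sq a ha]

lemma leaf_prod {n : ℕ} (A : Finset (Fin n → ℝ)) (β : Fin n → ℝ) (hβA : β ∉ A) (p m : ℕ)
    (pA : (Fin n → ℝ) → ℕ) (σ : ℕ → Fin n → ℝ)
    (hσmem : ∀ j ∈ Finset.Icc 1 (2 ^ m), σ j ∈ A ∨ σ j = β)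
    (hσA : ∀ α ∈ A, ((Finset.Icc 1 (2 ^ m)).filter fun j => σ j = α).card = pA α)
    (hσβ : ((Finset.Icc 1 (2 ^ m)).filter fun j => σ j = β).card = 2 ^ m - p)
    (c : (Fin n → ℝ) → ℝ) (t : ℝ) :
    ∏ j ∈ Finset.Icc 1 (2 ^ m), (if σ j ∈ A then c (σ j) else t)
      = (∏ α ∈ A, c α ^ pA α) * t ^ (2 ^ m - p) := by
  rw [← Finset.prod_fiberwise_of_maps_to (t := insert β A) (g := σ)
    (by intro j hj; rcases hσmem j hj with h | h <;> simp [h])]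
  rw [Finset.prod_insert hβA, mul_comm]
  congr 1
  · apply Finset.prod_congr rfl
    intro α hα
    rw [← hσA α hα, ← Finset.prod_const]
    apply Finset.prod_congr rfl
    intro j hj
    simp only [Finset.mem_filter] at hj
    simp [hj.2, hα]
  · rw [← hσβ, ← Finset.prod_const]
    apply Finset.prod_congr rfl
    intro j hj
    simp only [Finset.mem_filter] at hj
    simp [hj.2, hβA]

lemma exists_affine (n : ℕ) (A : Finset (Fin n → ℝ))
    (hind : AffineIndependent ℝ (fun x : A => (x : Fin n → ℝ))) (hA : A.Nonempty)
    (v : (Fin n → ℝ) → ℝ) :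
    ∃ (y : Fin n → ℝ) (s : ℝ), ∀ α ∈ A, ∑ i, α i * y i = v α + s := by
  obtain ⟨a0, ha0⟩ := hA
  have hl := (affineIndependent_iff_linearIndependent_vsub ℝ _ (⟨a0, ha0⟩ : A)).1 hind
  obtain ⟨f, hf⟩ := LinearMap.exists_extend
    ((Finsupp.linearCombination ℝ (fun a : {x : A // x ≠ ⟨a0, ha0⟩} => v a.1 - v a0)).comp
      (hl.repr : _ →ₗ[ℝ] _))
  have key : ∀ α ∈ A, f α = v α + (f a0 - v a0) := by
    intro α hα
    by_cases h : α = a0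
    · subst h; ring
    · have h2 := LinearMap.congr_fun hf
        ⟨α - a0, Submodule.subset_span ⟨⟨⟨α, hα⟩, by simpa using h⟩, rfl⟩⟩
      have h3 := hl.repr_eq_single ⟨⟨α, hα⟩, by simpa using h⟩
        ⟨α - a0, Submodule.subset_span ⟨⟨⟨α, hα⟩, by simpa using h⟩, rfl⟩⟩ rfl
      simp only [LinearMap.comp_apply, LinearEquiv.coe_coe, h3, Submodule.subtype_apply] at h2
      simp at h2
      linarith
  refine ⟨fun i => f (Pi.single i 1), f a0 - v a0, fun α hα => ?_⟩
  rw [← key α hα]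
  have := LinearMap.pi_apply_eq_sum_univ f α
  rw [this]
  apply Finset.sum_congr rfl
  intro i _
  rw [smul_eq_mul]
  refine congrArg (fun z => α i * f z) ?_
  ext j
  simp [Pi.single_apply, eq_comm]

lemma beta_dot (n : ℕ) (A : Finset (Fin n → ℝ)) (β : Fin n → ℝ) (w : (Fin n → ℝ) → ℝ)
    (hb : ∑ α ∈ A, w α • α = β) (y : Fin n → ℝ) :
    ∑ i, β i * y i = ∑ α ∈ A, w α * ∑ i, α i * y i := by
  subst hb
  simp only [Finset.sum_apply, Pi.smul_apply, smul_eq_mul, Finset.sum_mul, Finset.mul_sum]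
  rw [Finset.sum_comm]
  simp only [mul_assoc]

/-- strictly positive case -/
lemma circuit_pos (n : ℕ) (A : Finset (Fin n → ℝ)) (β : Fin n → ℝ)
    (hind : AffineIndependent ℝ (fun x : A => (x : Fin n → ℝ)))
    (w : (Fin n → ℝ) → ℝ) (hw : ∀ α ∈ A, 0 < w α) (hw1 : ∑ α ∈ A, w α = 1)
    (hb : ∑ α ∈ A, w α • α = β) (c : (Fin n → ℝ) → ℝ) (cβ : ℝ) (hc : ∀ α ∈ A, 0 < c α)
    (h : ∀ y : Fin n → ℝ,
      0 ≤ ∑ α ∈ A, c α * Real.exp (∑ i, α i * y i) + cβ * Real.exp (∑ i, β i * y i)) :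
    0 ≤ ∏ α ∈ A, (c α / w α) ^ w α + cβ := by
  have hA : A.Nonempty := by
    rw [Finset.nonempty_iff_ne_empty]; rintro rfl; simp at hw1
  obtain ⟨y, s, hy⟩ := exists_affine n A hind hA (fun α => - Real.log (c α / w α))
  have h1 := h y
  have e1 : ∑ α ∈ A, c α * Real.exp (∑ i, α i * y i) = Real.exp s := by
    rw [← one_mul (Real.exp s), ← hw1, Finset.sum_mul]
    apply Finset.sum_congr rfl
    intro α hα
    have := hc α hα
    have := hw α hα
    rw [hy α hα, Real.exp_add, Real.exp_neg, Real.exp_log (by positivity)]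
    field_simp
  have e2 : Real.exp s = Real.exp (∑ i, β i * y i) * ∏ α ∈ A, (c α / w α) ^ w α := by
    rw [beta_dot n A β w hb y]
    have : ∏ α ∈ A, (c α / w α) ^ w α
        = Real.exp (∑ α ∈ A, w α * Real.log (c α / w α)) := by
      rw [Real.exp_sum]
      apply Finset.prod_congr rfl
      intro α hα
      have := hc α hα
      have := hw α hα
      rw [Real.rpow_def_of_pos (by positivity), mul_comm]
    rw [this, ← Real.exp_add, ← Finset.sum_add_distrib]
    congr 1
    rw [← one_mul s, ← hw1, Finset.sum_mul]
    apply Finset.sum_congr rfl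
    intro α hα
    rw [hy α hα]; ring
  rw [e1, e2] at h1
  have h2 : 0 ≤ Real.exp (∑ i, β i * y i) * (∏ α ∈ A, (c α / w α) ^ w α + cβ) := by linarith
  exact nonneg_of_mul_nonneg_right h2 (Real.exp_pos _)

lemma circuit_nonneg (n : ℕ) (A : Finset (Fin n → ℝ)) (β : Fin n → ℝ)
    (hind : AffineIndependent ℝ (fun x : A => (x : Fin n → ℝ)))
    (w : (Fin n → ℝ) → ℝ) (hw : ∀ α ∈ A, 0 < w α) (hw1 : ∑ α ∈ A, w α = 1)
    (hb : ∑ α ∈ A, w α • α = β) (c : (Fin n → ℝ) → ℝ) (cβ : ℝ) (hc : ∀ α ∈ A, 0 ≤ c α)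
    (h : ∀ y : Fin n → ℝ,
      0 ≤ ∑ α ∈ A, c α * Real.exp (∑ i, α i * y i) + cβ * Real.exp (∑ i, β i * y i)) :
    0 ≤ ∏ α ∈ A, (c α / w α) ^ w α + cβ := by
  have hcont : Continuous (fun ε : ℝ => ∏ α ∈ A, ((c α + ε) / w α) ^ w α + cβ) := by
    refine Continuous.add (continuous_finsetProd _ fun α hα => ?_) continuous_const
    exact Continuous.rpow_const (by fun_prop) (fun _ => Or.inr (hw α hα).le)
  have ht := (hcont.tendsto 0).mono_left (nhdsWithin_le_nhds (s := Set.Ioi 0))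
  simp only [add_zero] at ht
  refine ge_of_tendsto ht ?_
  filter_upwards [self_mem_nhdsWithin] with ε hε
  have hε : 0 < ε := hε
  refine circuit_pos n A β hind w hw hw1 hb (fun α => c α + ε) cβ
    (fun α hα => by have := hc α hα; positivity) (fun y => (h y).trans ?_)
  gcongr
  linarith

lemma circuit_conv (n : ℕ) (A : Finset (Fin n → ℝ)) (β : Fin n → ℝ)
    (w : (Fin n → ℝ) → ℝ) (hw : ∀ α ∈ A, 0 < w α) (hw1 : ∑ α ∈ A, w α = 1)
    (hb : ∑ α ∈ A, w α • α = β) (c : (Fin n → ℝ) → ℝ) (cβ : ℝ) (hc : ∀ α ∈ A, 0 ≤ c α)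
    (h : 0 ≤ ∏ α ∈ A, (c α / w α) ^ w α + cβ) (y : Fin n → ℝ) :
      0 ≤ ∑ α ∈ A, c α * Real.exp (∑ i, α i * y i) + cβ * Real.exp (∑ i, β i * y i) := by
  have ag := Real.geom_mean_le_arith_mean_weighted A w
    (fun α => c α / w α * Real.exp (∑ i, α i * y i)) (fun α hα => (hw α hα).le) hw1
    (fun α hα => mul_nonneg (div_nonneg (hc α hα) (hw α hα).le) (Real.exp_pos _).le)
  have e1 : ∑ α ∈ A, w α * (c α / w α * Real.exp (∑ i, α i * y i))
      = ∑ α ∈ A, c α * Real.exp (∑ i, α i * y i) := by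
    apply Finset.sum_congr rfl
    intro α hα
    have := hw α hα
    field_simp
  have e2 : ∏ α ∈ A, (c α / w α * Real.exp (∑ i, α i * y i)) ^ w α
      = (∏ α ∈ A, (c α / w α) ^ w α) * Real.exp (∑ i, β i * y i) := by
    rw [beta_dot n A β w hb y, Real.exp_sum, ← Finset.prod_mul_distrib]
    apply Finset.prod_congr rfl
    intro α hα
    rw [Real.mul_rpow (div_nonneg (hc α hα) (hw α hα).le) (Real.exp_pos _).le, ← Real.exp_mul,
      mul_comm (w α)]
  rw [e1, e2] at ag
  nlinarith [mul_nonneg h (Real.exp_pos (∑ i, β i * y i)).le]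

/-- Second-order (binary tree) characterization of the primal cone `Pᵉ(A, β)` for a
rational circuit `(A, β)` with leaf assignment `σ`, with `Λ = ∏_{α ∈ A} λ_α^{λ_α}`. -/
theorem stmt15 (n : ℕ) (A : Finset (Fin n → ℝ)) (β : Fin n → ℝ)
    (hind : AffineIndependent ℝ (fun x : A => (x : Fin n → ℝ))) (hβA : β ∉ A)
    (p : ℕ) (pA : (Fin n → ℝ) → ℕ) (hp : 0 < p) (hpA : ∀ α ∈ A, 0 < pA α)
    (hpsum : ∑ α ∈ A, pA α = p)
    (hbary : ∑ α ∈ A, ((pA α : ℝ) / p) • α = β)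
    (m : ℕ) (hm : m = Nat.clog 2 p)
    (σ : ℕ → (Fin n → ℝ))
    (hσmem : ∀ j ∈ Finset.Icc 1 (2 ^ m), σ j ∈ A ∨ σ j = β)
    (hσA : ∀ α ∈ A, ((Finset.Icc 1 (2 ^ m)).filter fun j => σ j = α).card = pA α)
    (hσβ : ((Finset.Icc 1 (2 ^ m)).filter fun j => σ j = β).card = 2 ^ m - p)
    (Λ : ℝ) (hΛ : Λ = ∏ α ∈ A, ((pA α : ℝ) / p) ^ ((pA α : ℝ) / p))
    (c : (Fin n → ℝ) → ℝ) :
    InPe n A β c ↔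
      ∃ (xβ : ℝ) (x : ℕ → ℕ → ℝ),
        (∀ j ∈ Finset.Icc 1 (2 ^ m),
          x 0 j = if σ j ∈ A then c (σ j) else Λ * xβ) ∧
        (∀ k, k ≤ m → ∀ i ∈ Finset.Icc 1 (2 ^ (m - k)), 0 ≤ x k i) ∧
        0 ≤ xβ + c β ∧
        Λ * xβ ≤ x m 1 ∧
        (∀ k, 1 ≤ k → k ≤ m → ∀ i ∈ Finset.Icc 1 (2 ^ (m - k)),
          (x k i) ^ 2 ≤ x (k - 1) (2 * i - 1) * x (k - 1) (2 * i)) := by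
  have hp' : (0 : ℝ) < p := by exact_mod_cast hp
  have hw : ∀ α ∈ A, (0 : ℝ) < (pA α : ℝ) / p := fun α hα =>
    div_pos (by exact_mod_cast hpA α hα) hp'
  have hw1 : ∑ α ∈ A, (pA α : ℝ) / p = 1 := by
    rw [← Finset.sum_div, div_eq_one_iff_eq hp'.ne', ← hpsum]; push_cast; rfl
  have hpm : p ≤ 2 ^ m := by rw [hm]; exact Nat.le_pow_clog (by norm_num) p
  have hΛpos : 0 < Λ := by
    rw [hΛ]; exact Finset.prod_pos fun α hα => Real.rpow_pos_of_pos (hw α hα) _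
  have hΘ : ∀ hc : ∀ α ∈ A, 0 ≤ c α,
      (Λ * ∏ α ∈ A, (c α / ((pA α : ℝ) / p)) ^ ((pA α : ℝ) / p)) ^ p
        = ∏ α ∈ A, c α ^ pA α := by
    intro hc
    rw [hΛ, ← Finset.prod_mul_distrib, ← Finset.prod_pow]
    apply Finset.prod_congr rfl
    intro α hα
    have := hw α hα
    rw [← Real.mul_rpow this.le (div_nonneg (hc α hα) this.le), mul_div_cancel₀ _ this.ne',
      ← Real.rpow_natCast, ← Real.rpow_mul (hc α hα), div_mul_cancel₀ _ hp'.ne',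
      Real.rpow_natCast]
  have hΘ0 : ∀ hc : ∀ α ∈ A, 0 ≤ c α,
      0 ≤ ∏ α ∈ A, (c α / ((pA α : ℝ) / p)) ^ ((pA α : ℝ) / p) := fun hc =>
    Finset.prod_nonneg fun α hα => Real.rpow_nonneg (div_nonneg (hc α hα) (hw α hα).le) _
  constructor
  · rintro ⟨hc, hy⟩
    have h1 := circuit_nonneg n A β hind _ hw hw1 hbary c (c β) hc hy
    have hΘ := hΘ hc
    have hΘ0 := hΘ0 hc
    set Θ := ∏ α ∈ A, (c α / ((pA α : ℝ) / p)) ^ ((pA α : ℝ) / p)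
    have ha : ∀ j, 0 ≤ (fun j => if σ j ∈ A then c (σ j) else Λ * Θ) j := by
      intro j
      dsimp only
      split_ifs with h
      · exact hc _ h
      · positivity
    refine ⟨Θ, gtree (fun j => if σ j ∈ A then c (σ j) else Λ * Θ), fun j _ => rfl,
      fun k _ i _ => gtree_nonneg _ ha k i, h1, ?_, ?_⟩
    · have h2 := gtree_prod m _ ha m le_rfl
      rw [leaf_prod A β hβA p m pA σ hσmem hσA hσβ, ← hΘ, ← pow_add,
        Nat.add_sub_cancel' hpm] at h2
      simp only [Nat.sub_self, pow_zero, Finset.Icc_self, Finset.prod_singleton] at h2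
      exact le_of_pow_le_pow_left₀ (by positivity) (gtree_nonneg _ ha _ _) h2.ge
    · intro k hk _ i _
      obtain ⟨k, rfl⟩ : ∃ k', k = k' + 1 := ⟨k - 1, by omega⟩
      exact (gtree_sq _ ha k i).le
  · rintro ⟨xβ, x, hx0, hnn, hcβ, hm1, hsq⟩
    have hc : ∀ α ∈ A, 0 ≤ c α := by
      intro α hα
      have : 0 < ((Finset.Icc 1 (2 ^ m)).filter fun j => σ j = α).card := by
        rw [hσA α hα]; exact hpA α hα
      obtain ⟨j, hj⟩ := Finset.card_pos.1 this
      simp only [Finset.mem_filter] at hj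
      have h1 := hnn 0 (Nat.zero_le _) j (by simpa using hj.1)
      rw [hx0 j hj.1, hj.2, if_pos hα] at h1
      exact h1
    refine ⟨hc, circuit_conv n A β _ hw hw1 hbary c (c β) hc ?_⟩
    have hΘ := hΘ hc
    have hΘ0 := hΘ0 hc
    set Θ := ∏ α ∈ A, (c α / ((pA α : ℝ) / p)) ^ ((pA α : ℝ) / p)
    suffices xβ ≤ Θ by linarith
    rcases le_or_gt xβ 0 with hx | hx
    · linarith
    · have h2 := tree_le m x hsq m le_rfl
      rw [Finset.prod_congr rfl hx0, leaf_prod A β hβA p m pA σ hσmem hσA hσβ, ← hΘ] at h2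
      simp only [Nat.sub_self, pow_zero, Finset.Icc_self, Finset.prod_singleton] at h2
      have hpos : 0 < Λ * xβ := by positivity
      have h3 := (pow_le_pow_left₀ hpos.le hm1 (2 ^ m)).trans h2
      have h4 : (Λ * xβ) ^ (2 ^ m) = (Λ * xβ) ^ p * (Λ * xβ) ^ (2 ^ m - p) := by
        rw [← pow_add, Nat.add_sub_cancel' hpm]
      rw [h4] at h3
      have h5 := le_of_mul_le_mul_right h3 (by positivity)
      have h6 := le_of_pow_le_pow_left₀ hp.ne' (by positivity) h5
      exact le_of_mul_le_mul_left h6 hΛpos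
end
end
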